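/- arXiv:2112.04265 — 3 statements merged into one kernel-verified Lean document; each statement's English description precedes it below -/
import Mathlib

section
/- For every positive integer p, the windmill C_5^p is graceful when p ≡ 0 or 3 (mod 4), and near graceful when p ≡ 1 or 2 (mod 4). -/
/-- The vertex type of a windmill whose vanes are cycles of lengths given by the list `L`:
`none` is the central vertex, and `some ⟨i, j⟩` is the `j`-th non-central vertex of the
`i`-th vane (a cycle of length `L.get i`, contributing `L.get i - 1` non-central vertices). -/
abbrev WindmillVertex (L : List ℕ) : Type :=
  Option (Σ i : Fin L.length, Fin (L.get i - 1))

/-- Base relation for the windmill graph: the central vertex is joined to the two ends of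
each vane's path, and consecutive vertices along each vane's path are joined. -/
def windmillRel (L : List ℕ) : WindmillVertex L → WindmillVertex L → Prop
  | none, some ⟨i, j⟩ => j.val = 0 ∨ j.val + 2 = L.get i
  | some ⟨i, j⟩, some ⟨i', j'⟩ => i.val = i'.val ∧ j'.val = j.val + 1
  | _, _ => False

/-- The windmill graph with vanes of cycle lengths given by `L`, all sharing one central
vertex.  `Windmill (List.replicate t n)` is `Cₙᵗ`. -/
def Windmill (L : List ℕ) : SimpleGraph (WindmillVertex L) :=
  SimpleGraph.fromRel (windmillRel L)

/-- The edge label induced by a vertex labelling `f`: the absolute difference of the labels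
of the two endpoints. -/
def edgeLabel {V : Type*} (f : V → ℕ) : Sym2 V → ℕ :=
  Sym2.lift ⟨fun u v => ((f u : ℤ) - (f v : ℤ)).natAbs,
    fun u v => by dsimp only; omega⟩

/-- `f` is a graceful labelling of the graph `G` with `m` edges: `f` is an injective map
into `{0, …, m}` and the induced edge labelling is a bijection onto `{1, …, m}`. -/
def IsGracefulLabelling {V : Type*} (G : SimpleGraph V) (m : ℕ) (f : V → ℕ) : Prop :=
  Function.Injective f ∧ (∀ v, f v ≤ m) ∧
    Set.BijOn (edgeLabel f) G.edgeSet (Set.Icc 1 m)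

/-- The graph `G`, with `m` edges, is graceful. -/
def IsGraceful {V : Type*} (G : SimpleGraph V) (m : ℕ) : Prop :=
  ∃ f, IsGracefulLabelling G m f

/-- `f` is a near graceful labelling of the graph `G` with `m` edges: `f` is an injective
map into `{0, …, m+1}` and the induced edge labelling is a bijection onto either
`{1, …, m}` or `{1, …, m-1, m+1}`. -/
def IsNearGracefulLabelling {V : Type*} (G : SimpleGraph V) (m : ℕ) (f : V → ℕ) : Prop :=
  Function.Injective f ∧ (∀ v, f v ≤ m + 1) ∧
    (Set.BijOn (edgeLabel f) G.edgeSet (Set.Icc 1 m) ∨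
      Set.BijOn (edgeLabel f) G.edgeSet (Set.Icc 1 (m - 1) ∪ {m + 1}))

/-- The graph `G`, with `m` edges, is near graceful. -/
def IsNearGraceful {V : Type*} (G : SimpleGraph V) (m : ℕ) : Prop :=
  ∃ f, IsNearGracefulLabelling G m f

/-- `Label data` for `p` vanes: the vane `i` has vertices `0, a i, b i, c i, d i` (in cyclic order),
and edge labels `a i, e i, f i, g i, d i`.  All labels are in `1..M`, and edge labels avoid `X`. -/
def HasLabels (p M X : ℕ) : Prop :=
  ∃ a b c d e f g : ℕ → ℕ,
    (∀ i < p, (1 ≤ a i ∧ a i ≤ M ∧ a i ≠ X) ∧ (1 ≤ b i ∧ b i ≤ M) ∧ (1 ≤ c i ∧ c i ≤ M) ∧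
      (1 ≤ d i ∧ d i ≤ M ∧ d i ≠ X) ∧ (1 ≤ e i ∧ e i ≤ M ∧ e i ≠ X) ∧
      (1 ≤ f i ∧ f i ≤ M ∧ f i ≠ X) ∧ (1 ≤ g i ∧ g i ≤ M ∧ g i ≠ X) ∧
      (a i = b i + e i ∨ b i = a i + e i) ∧ (b i = c i + f i ∨ c i = b i + f i) ∧
      (c i = d i + g i ∨ d i = c i + g i)) ∧
    (∀ i < p, ∀ j < p,
      ((a i = a j → i = j) ∧ (b i = b j → i = j) ∧ (c i = c j → i = j) ∧ (d i = d j → i = j) ∧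
        a i ≠ b j ∧ a i ≠ c j ∧ a i ≠ d j ∧ b i ≠ c j ∧ b i ≠ d j ∧ c i ≠ d j) ∧
      (e i = e j → i = j) ∧ (f i = f j → i = j) ∧ (g i = g j → i = j) ∧
        a i ≠ e j ∧ a i ≠ f j ∧ a i ≠ g j ∧ d i ≠ e j ∧ d i ≠ f j ∧ d i ≠ g j ∧
        e i ≠ f j ∧ e i ≠ g j ∧ f i ≠ g j)

/-- Relational version of `HasLabels`. -/
theorem HasLabels.of_rel {p M X : ℕ} (R : ℕ → ℕ → ℕ → ℕ → ℕ → ℕ → ℕ → ℕ → Prop)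
    (hex : ∀ i < p, ∃ a b c d e f g, R i a b c d e f g)
    (h1 : ∀ i a b c d e f g, i < p → R i a b c d e f g →
      (1 ≤ a ∧ a ≤ M ∧ a ≠ X) ∧ (1 ≤ b ∧ b ≤ M) ∧ (1 ≤ c ∧ c ≤ M) ∧
      (1 ≤ d ∧ d ≤ M ∧ d ≠ X) ∧ (1 ≤ e ∧ e ≤ M ∧ e ≠ X) ∧
      (1 ≤ f ∧ f ≤ M ∧ f ≠ X) ∧ (1 ≤ g ∧ g ≤ M ∧ g ≠ X) ∧
      (a = b + e ∨ b = a + e) ∧ (b = c + f ∨ c = b + f) ∧ (c = d + g ∨ d = c + g))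
    (h2 : ∀ i a b c d e f g i' a' b' c' d' e' f' g', i < p → i' < p →
      R i a b c d e f g → R i' a' b' c' d' e' f' g' →
      ((a = a' → i = i') ∧ (b = b' → i = i') ∧ (c = c' → i = i') ∧ (d = d' → i = i') ∧
        a ≠ b' ∧ a ≠ c' ∧ a ≠ d' ∧ b ≠ c' ∧ b ≠ d' ∧ c ≠ d') ∧
      (e = e' → i = i') ∧ (f = f' → i = i') ∧ (g = g' → i = i') ∧
        a ≠ e' ∧ a ≠ f' ∧ a ≠ g' ∧ d ≠ e' ∧ d ≠ f' ∧ d ≠ g' ∧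
        e ≠ f' ∧ e ≠ g' ∧ f ≠ g') : HasLabels p M X := by
  have hex' : ∀ i, ∃ a b c d e f g, i < p → R i a b c d e f g := by
    intro i
    by_cases hi : i < p
    · obtain ⟨a, b, c, d, e, f, g, h⟩ := hex i hi
      exact ⟨a, b, c, d, e, f, g, fun _ => h⟩
    · exact ⟨0, 0, 0, 0, 0, 0, 0, fun h => absurd h hi⟩
  choose a b c d e f g h using hex'
  exact ⟨a, b, c, d, e, f, g, fun i hi => h1 _ _ _ _ _ _ _ _ hi (h i hi),
    fun i hi j hj => h2 _ _ _ _ _ _ _ _ _ _ _ _ _ _ _ _ hi hj (h i hi) (h j hj)⟩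

section WindmillFive

variable {L : List ℕ} (hL : ∀ i, L.get i = 5)

/-- The `j`-th vertex of the `i`-th vane. -/
def vtx (i : Fin L.length) (j : ℕ) (hj : j < 4) : WindmillVertex L :=
  some ⟨i, ⟨j, by rw [hL i]; omega⟩⟩

theorem vtx_cases (v : WindmillVertex L) : v = none ∨ ∃ i j hj, v = vtx hL i j hj := by
  rcases v with _ | ⟨i, j, hj⟩
  · exact Or.inl rfl
  · refine Or.inr ⟨i, j, ?_, rfl⟩
    rw [hL i] at hj; omega

theorem rel_none_vtx (i : Fin L.length) (j : ℕ) (hj : j < 4) :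
    windmillRel L none (vtx hL i j hj) ↔ j = 0 ∨ j = 3 := by
  change (j = 0 ∨ j + 2 = L.get i) ↔ _
  rw [hL i]; omega

theorem rel_vtx_vtx (i : Fin L.length) (j : ℕ) (hj : j < 4) (i' : Fin L.length) (j' : ℕ)
    (hj' : j' < 4) :
    windmillRel L (vtx hL i j hj) (vtx hL i' j' hj') ↔ i = i' ∧ j' = j + 1 := by
  change (i.val = i'.val ∧ j' = j + 1) ↔ _
  rw [Fin.ext_iff]

theorem vtx_inj {i : Fin L.length} {j : ℕ} {hj : j < 4} {i' : Fin L.length} {j' : ℕ}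
    {hj' : j' < 4} : vtx hL i j hj = vtx hL i' j' hj' ↔ i = i' ∧ j = j' := by
  constructor
  · intro h
    unfold vtx at h
    have h := Option.some.inj h
    obtain rfl : i = i' := congrArg Sigma.fst h
    simpa using h
  · rintro ⟨rfl, rfl⟩; rfl

/-- The five edges of the `i`-th vane. -/
def vedge (i : Fin L.length) : ℕ → Sym2 (WindmillVertex L)
  | 0 => s(none, vtx hL i 0 (by omega))
  | 1 => s(vtx hL i 0 (by omega), vtx hL i 1 (by omega))
  | 2 => s(vtx hL i 1 (by omega), vtx hL i 2 (by omega))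
  | 3 => s(vtx hL i 2 (by omega), vtx hL i 3 (by omega))
  | _ => s(none, vtx hL i 3 (by omega))

theorem vedge_mem (i : Fin L.length) (k : ℕ) : vedge hL i k ∈ (Windmill L).edgeSet := by
  have hn : ∀ j hj, (none : WindmillVertex L) ≠ vtx hL i j hj := fun j hj h => by
    unfold vtx at h; cases h
  rcases k with _ | _ | _ | _ | k <;>
    simp only [vedge, Windmill, SimpleGraph.mem_edgeSet, SimpleGraph.fromRel_adj] <;>
    refine ⟨?_, Or.inl ?_⟩ <;>
    first
    | exact hn _ _
    | (rw [Ne, vtx_inj]; omega)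
    | (rw [rel_none_vtx]; omega)
    | (rw [rel_vtx_vtx]; exact ⟨rfl, rfl⟩)

theorem rel_vedge {u v : WindmillVertex L} (h : windmillRel L u v) :
    ∃ i, ∃ k < 5, s(u, v) = vedge hL i k := by
  rcases vtx_cases hL u with rfl | ⟨i, j, hj, rfl⟩
  · rcases vtx_cases hL v with rfl | ⟨i, j, hj, rfl⟩
    · exact h.elim
    · rcases (rel_none_vtx hL i j hj).1 h with rfl | rfl
      · exact ⟨i, 0, by omega, rfl⟩
      · exact ⟨i, 4, by omega, rfl⟩
  · rcases vtx_cases hL v with rfl | ⟨i', j', hj', rfl⟩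
    · exact h.elim
    · obtain ⟨rfl, rfl⟩ := (rel_vtx_vtx hL i j hj i' j' hj').1 h
      obtain rfl | rfl | rfl : j = 0 ∨ j = 1 ∨ j = 2 := by omega
      · exact ⟨i, 1, by omega, rfl⟩
      · exact ⟨i, 2, by omega, rfl⟩
      · exact ⟨i, 3, by omega, rfl⟩

theorem edge_vedge {e : Sym2 (WindmillVertex L)} (he : e ∈ (Windmill L).edgeSet) :
    ∃ i, ∃ k < 5, e = vedge hL i k := by
  induction e using Sym2.ind with
  | _ u v =>
    rw [SimpleGraph.mem_edgeSet, Windmill, SimpleGraph.fromRel_adj] at he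
    rcases he.2 with h | h
    · exact rel_vedge hL h
    · rw [Sym2.eq_swap]; exact rel_vedge hL h

/-- Turn label data into a labelling of the windmill. -/
theorem exists_labelling {L : List ℕ} (hL : ∀ i, L.get i = 5) {M X : ℕ} (h : HasLabels L.length M X)
    (hcard : ((Finset.Icc 1 M).erase X).card = 5 * L.length) :
    ∃ f : WindmillVertex L → ℕ, Function.Injective f ∧ (∀ v, f v ≤ M) ∧
      Set.BijOn (edgeLabel f) (Windmill L).edgeSet ((Finset.Icc 1 M).erase X : Finset ℕ) := by
  obtain ⟨a, b, c, d, e, f, g, h1, h2⟩ := h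
  let lab : ℕ → ℕ → ℕ := fun i j =>
    if j = 0 then a i else if j = 1 then b i else if j = 2 then c i else d i
  let F : WindmillVertex L → ℕ := fun v => match v with
    | none => 0
    | some ⟨i, j⟩ => lab i.val j.val
  have F0 : F none = 0 := rfl
  have Fv : ∀ i j hj, F (vtx hL i j hj) = lab i.val j := fun _ _ _ => rfl
  have labpos : ∀ i < L.length, ∀ j < 4, 1 ≤ lab i j ∧ lab i j ≤ M := by
    intro i hi j hj
    obtain ⟨ha, hb, hc, hd, -⟩ := h1 i hi
    simp only [lab]
    split_ifs <;> omega
  have labinj : ∀ i < L.length, ∀ i' < L.length, ∀ j < 4, ∀ j' < 4,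
      lab i j = lab i' j' → i = i' ∧ j = j' := by
    intro i hi i' hi' j hj j' hj' hh
    obtain ⟨A1, A2, A3, A4, A5, A6, A7, A8, A9, A10⟩ := (h2 i hi i' hi').1
    obtain ⟨-, -, -, -, B5, B6, B7, B8, B9, B10⟩ := (h2 i' hi' i hi).1
    simp only [lab] at hh
    split_ifs at hh
    all_goals first
      | exact ⟨A1 hh, by omega⟩
      | exact ⟨A2 hh, by omega⟩
      | exact ⟨A3 hh, by omega⟩
      | exact ⟨A4 hh, by omega⟩
      | (exfalso; first
        | exact A5 hh | exact A6 hh | exact A7 hh | exact A8 hh | exact A9 hh | exact A10 hh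
        | exact B5 hh.symm | exact B6 hh.symm | exact B7 hh.symm | exact B8 hh.symm
        | exact B9 hh.symm | exact B10 hh.symm)
  -- edge labels
  let el : ℕ → ℕ → ℕ := fun i k =>
    if k = 0 then a i else if k = 1 then e i else if k = 2 then f i else if k = 3 then g i else d i
  have elF : ∀ (i : Fin L.length), ∀ k < 5, edgeLabel F (vedge hL i k) = el i.val k := by
    intro i k hk
    obtain ⟨ha, hb, hc, hd, he, hf, hg, r1, r2, r3⟩ := h1 i.val i.isLt
    obtain rfl | rfl | rfl | rfl | rfl : k = 0 ∨ k = 1 ∨ k = 2 ∨ k = 3 ∨ k = 4 := by omega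
    · change (((0 : ℕ) : ℤ) - (a i.val : ℤ)).natAbs = a i.val
      omega
    · change ((a i.val : ℤ) - (b i.val : ℤ)).natAbs = e i.val
      omega
    · change ((b i.val : ℤ) - (c i.val : ℤ)).natAbs = f i.val
      omega
    · change ((c i.val : ℤ) - (d i.val : ℤ)).natAbs = g i.val
      omega
    · change (((0 : ℕ) : ℤ) - (d i.val : ℤ)).natAbs = d i.val
      omega
  have elmem : ∀ i < L.length, ∀ k < 5, el i k ∈ (Finset.Icc 1 M).erase X := by
    intro i hi k hk
    obtain ⟨ha, hb, hc, hd, he, hf, hg, -⟩ := h1 i hi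
    rw [Finset.mem_erase, Finset.mem_Icc]
    simp only [el]
    split_ifs <;> omega
  have elinj : ∀ i < L.length, ∀ i' < L.length, ∀ k < 5, ∀ k' < 5,
      el i k = el i' k' → i = i' ∧ k = k' := by
    intro i hi i' hi' k hk k' hk' hh
    obtain ⟨⟨A1, -, -, A2, -, -, A3, -, -, -⟩, A4, A5, A6, C1, C2, C3, C4, C5, C6, C7, C8, C9⟩ :=
      h2 i hi i' hi'
    obtain ⟨⟨-, -, -, -, -, -, B3, -, -, -⟩, -, -, -, D1, D2, D3, D4, D5, D6, D7, D8, D9⟩ :=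
      h2 i' hi' i hi
    simp only [el] at hh
    split_ifs at hh
    all_goals first
      | exact ⟨A1 hh, by omega⟩
      | exact ⟨A2 hh, by omega⟩
      | exact ⟨A4 hh, by omega⟩
      | exact ⟨A5 hh, by omega⟩
      | exact ⟨A6 hh, by omega⟩
      | (exfalso; first
        | exact A3 hh | exact C1 hh | exact C2 hh | exact C3 hh | exact C4 hh | exact C5 hh
        | exact C6 hh | exact C7 hh | exact C8 hh | exact C9 hh
        | exact B3 hh.symm | exact D1 hh.symm | exact D2 hh.symm | exact D3 hh.symm
        | exact D4 hh.symm | exact D5 hh.symm | exact D6 hh.symm | exact D7 hh.symm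
        | exact D8 hh.symm | exact D9 hh.symm)
  refine ⟨F, ?_, ?_, ?_, ?_, ?_⟩
  · intro u v huv
    rcases vtx_cases hL u with rfl | ⟨i, j, hj, rfl⟩ <;>
      rcases vtx_cases hL v with rfl | ⟨i', j', hj', rfl⟩
    · rfl
    · rw [F0, Fv] at huv
      have := labpos i' i'.isLt j' hj'
      omega
    · rw [F0, Fv] at huv
      have := labpos i i.isLt j hj
      omega
    · rw [Fv, Fv] at huv
      obtain ⟨hi, hj⟩ := labinj i i.isLt i' i'.isLt j hj j' hj' huv
      exact (vtx_inj hL).2 ⟨Fin.ext hi, hj⟩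
  · intro v
    rcases vtx_cases hL v with rfl | ⟨i, j, hj, rfl⟩
    · exact Nat.zero_le _
    · exact (labpos i i.isLt j hj).2
  · intro s hs
    obtain ⟨i, k, hk, rfl⟩ := edge_vedge hL hs
    rw [elF i k hk]
    exact elmem i i.isLt k hk
  · intro s hs t ht hst
    obtain ⟨i, k, hk, rfl⟩ := edge_vedge hL hs
    obtain ⟨i', k', hk', rfl⟩ := edge_vedge hL ht
    rw [elF i k hk, elF i' k' hk'] at hst
    obtain ⟨hi, rfl⟩ := elinj i i.isLt i' i'.isLt k hk k' hk' hst
    obtain rfl := Fin.ext hi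
    rfl
  · intro n hn
    have himg : ((Finset.range L.length) ×ˢ (Finset.range 5)).image (fun x => el x.1 x.2) =
        (Finset.Icc 1 M).erase X := by
      apply Finset.eq_of_subset_of_card_le
      · intro m hm
        obtain ⟨⟨i, k⟩, hx, rfl⟩ := Finset.mem_image.1 hm
        rw [Finset.mem_product, Finset.mem_range, Finset.mem_range] at hx
        exact elmem i hx.1 k hx.2
      · rw [hcard, Finset.card_image_of_injOn]
        · simp [mul_comm]
        · rintro ⟨i, k⟩ hx ⟨i', k'⟩ hx' hh
          simp only [Finset.coe_product, Finset.coe_range, Set.mem_prod, Set.mem_Iio] at hx hx'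
          obtain ⟨rfl, rfl⟩ := elinj i hx.1 i' hx'.1 k hx.2 k' hx'.2 hh
          rfl
    rw [Finset.mem_coe, ← himg] at hn
    obtain ⟨⟨i, k⟩, hx, rfl⟩ := Finset.mem_image.1 hn
    rw [Finset.mem_product, Finset.mem_range, Finset.mem_range] at hx
    exact ⟨vedge hL ⟨i, hx.1⟩ k, vedge_mem hL _ _, elF ⟨i, hx.1⟩ k hx.2⟩

end WindmillFive

theorem replicate_get (p : ℕ) : ∀ i, (List.replicate p 5).get i = 5 := by
  intro i; simp

theorem graceful_of_labels {p : ℕ} (h : HasLabels p (5 * p) 0) :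
    IsGraceful (Windmill (List.replicate p 5)) (5 * p) := by
  have hlen : (List.replicate p 5).length = p := List.length_replicate
  have hE : (Finset.Icc 1 (5 * p)).erase 0 = Finset.Icc 1 (5 * p) := by
    apply Finset.erase_eq_of_notMem; simp
  obtain ⟨f, hf, hb, hbij⟩ := exists_labelling (replicate_get p) (M := 5 * p) (X := 0)
    (by rw [hlen]; exact h) (by rw [hE, hlen]; simp)
  rw [hE, Finset.coe_Icc] at hbij
  exact ⟨f, hf, hb, hbij⟩

theorem near_graceful_of_labels {p : ℕ} (hp : 1 ≤ p) (h : HasLabels p (5 * p + 1) (5 * p)) :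
    IsNearGraceful (Windmill (List.replicate p 5)) (5 * p) := by
  have hlen : (List.replicate p 5).length = p := List.length_replicate
  obtain ⟨f, hf, hb, hbij⟩ := exists_labelling (replicate_get p) (M := 5 * p + 1) (X := 5 * p)
    (by rw [hlen]; exact h)
    (by rw [hlen, Finset.card_erase_of_mem (by rw [Finset.mem_Icc]; omega)]; simp)
  refine ⟨f, hf, hb, Or.inr ?_⟩
  have hS : (((Finset.Icc 1 (5 * p + 1)).erase (5 * p) : Finset ℕ) : Set ℕ) =
      Set.Icc 1 (5 * p - 1) ∪ {5 * p + 1} := by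
    ext n
    simp only [Finset.coe_erase, Finset.coe_Icc, Set.mem_sdiff, Set.mem_Icc, Set.mem_singleton_iff,
      Set.mem_union]
    omega
  rw [← hS]
  exact hbij

/-- The explicit labelling for `p = 4 * q`. -/
theorem labels_0 (q : ℕ) (hq : 1 ≤ q) : HasLabels (4 * q) (20 * q) (0) := by
  apply HasLabels.of_rel (fun i a b c d e f g =>
    (∃ j, i = j ∧ i < 2 * q ∧ a = 1 + j ∧ b = 16 * q - j ∧ c = 4 * q + j ∧ d = 20 * q - j ∧ e = 16 * q - 1 - 2 * j ∧ f = 12 * q - 2 * j ∧ g = 16 * q - 2 * j) ∨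
    (∃ j, i = 2 * q + j ∧ i < 3 * q ∧ a = 6 * q + 1 + j ∧ b = 4 * q - 1 - j ∧ c = 12 * q + j ∧ d = 18 * q - j ∧ e = 2 * q + 2 + 2 * j ∧ f = 8 * q + 1 + 2 * j ∧ g = 6 * q - 2 * j) ∨
    (∃ j, i = 3 * q + j ∧ i < 4 * q - 1 ∧ a = 7 * q + 2 + j ∧ b = 3 * q - 1 - j ∧ c = 13 * q + j ∧ d = 17 * q - 1 - j ∧ e = 4 * q + 3 + 2 * j ∧ f = 10 * q + 1 + 2 * j ∧ g = 4 * q - 1 - 2 * j) ∨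
    (i = 4 * q - 1 ∧ a = 17 * q ∧ b = 10 * q - 1 ∧ c = 14 * q ∧ d = 12 * q - 1 ∧ e = 7 * q + 1 ∧ f = 4 * q + 1 ∧ g = 2 * q + 1))
  · intro i hi
    by_cases h0 : i < 2 * q
    · exact ⟨_, _, _, _, _, _, _, Or.inl ⟨i - (0), by omega, by omega, rfl, rfl, rfl, rfl, rfl, rfl, rfl⟩⟩
    by_cases h1 : i < 3 * q
    · exact ⟨_, _, _, _, _, _, _, Or.inr (Or.inl ⟨i - (2 * q), by omega, by omega, rfl, rfl, rfl, rfl, rfl, rfl, rfl⟩)⟩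
    by_cases h2 : i < 4 * q - 1
    · exact ⟨_, _, _, _, _, _, _, Or.inr (Or.inr (Or.inl ⟨i - (3 * q), by omega, by omega, rfl, rfl, rfl, rfl, rfl, rfl, rfl⟩))⟩
    exact ⟨_, _, _, _, _, _, _, Or.inr (Or.inr (Or.inr (⟨by omega, rfl, rfl, rfl, rfl, rfl, rfl, rfl⟩)))⟩
  · rintro i a b c d e f g hi (⟨j, h1, h2, ha, hb, hc, hd, he, hf, hg⟩ | ⟨j, h1, h2, ha, hb, hc, hd, he, hf, hg⟩ | ⟨j, h1, h2, ha, hb, hc, hd, he, hf, hg⟩ | ⟨h1, ha, hb, hc, hd, he, hf, hg⟩) <;>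
      (refine ⟨?_, ?_, ?_, ?_, ?_, ?_, ?_, ?_, ?_, ?_⟩ <;> omega)
  · rintro i a b c d e f g i' a' b' c' d' e' f' g' hi hi'
      (⟨j, h1, h2, ha, hb, hc, hd, he, hf, hg⟩ | ⟨j, h1, h2, ha, hb, hc, hd, he, hf, hg⟩ | ⟨j, h1, h2, ha, hb, hc, hd, he, hf, hg⟩ | ⟨h1, ha, hb, hc, hd, he, hf, hg⟩)
      (⟨j', k1, k2, ka, kb, kc, kd, ke, kf, kg⟩ | ⟨j', k1, k2, ka, kb, kc, kd, ke, kf, kg⟩ | ⟨j', k1, k2, ka, kb, kc, kd, ke, kf, kg⟩ | ⟨k1, ka, kb, kc, kd, ke, kf, kg⟩) <;>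
      subst ha hb hc hd he hf hg ka kb kc kd ke kf kg <;>
      (refine ⟨⟨?_, ?_, ?_, ?_, ?_, ?_, ?_, ?_, ?_, ?_⟩, ?_, ?_, ?_, ?_, ?_, ?_, ?_, ?_, ?_, ?_, ?_, ?_⟩ <;> omega)

/-- The explicit labelling for `p = 4 * q + 1`. -/
theorem labels_1 (q : ℕ) : HasLabels (4 * q + 1) (20 * q + 6) (20 * q + 5) := by
  apply HasLabels.of_rel (fun i a b c d e f g =>
    (∃ j, i = j ∧ i < 2 * q ∧ a = 14 * q + 4 + j ∧ b = 4 * q - 1 - j ∧ c = 4 * q + 1 + j ∧ d = 18 * q + 3 - j ∧ e = 10 * q + 5 + 2 * j ∧ f = 2 + 2 * j ∧ g = 14 * q + 2 - 2 * j) ∨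
    (∃ j, i = 2 * q + j ∧ i < 3 * q ∧ a = 8 * q + 2 + j ∧ b = 8 * q + 1 - j ∧ c = 12 * q + 3 + j ∧ d = 20 * q + 4 - j ∧ e = 1 + 2 * j ∧ f = 4 * q + 2 + 2 * j ∧ g = 8 * q + 1 - 2 * j) ∨
    (∃ j, i = 3 * q + j ∧ i < 4 * q ∧ a = 9 * q + 4 + j ∧ b = 7 * q + 1 - j ∧ c = 13 * q + 3 + j ∧ d = 19 * q + 4 - j ∧ e = 2 * q + 3 + 2 * j ∧ f = 6 * q + 2 + 2 * j ∧ g = 6 * q + 1 - 2 * j) ∨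
    (i = 4 * q ∧ a = 20 * q + 6 ∧ b = 11 * q + 3 ∧ c = 20 * q + 5 ∧ d = 18 * q + 4 ∧ e = 9 * q + 3 ∧ f = 9 * q + 2 ∧ g = 2 * q + 1))
  · intro i hi
    by_cases h0 : i < 2 * q
    · exact ⟨_, _, _, _, _, _, _, Or.inl ⟨i - (0), by omega, by omega, rfl, rfl, rfl, rfl, rfl, rfl, rfl⟩⟩
    by_cases h1 : i < 3 * q
    · exact ⟨_, _, _, _, _, _, _, Or.inr (Or.inl ⟨i - (2 * q), by omega, by omega, rfl, rfl, rfl, rfl, rfl, rfl, rfl⟩)⟩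
    by_cases h2 : i < 4 * q
    · exact ⟨_, _, _, _, _, _, _, Or.inr (Or.inr (Or.inl ⟨i - (3 * q), by omega, by omega, rfl, rfl, rfl, rfl, rfl, rfl, rfl⟩))⟩
    exact ⟨_, _, _, _, _, _, _, Or.inr (Or.inr (Or.inr (⟨by omega, rfl, rfl, rfl, rfl, rfl, rfl, rfl⟩)))⟩
  · rintro i a b c d e f g hi (⟨j, h1, h2, ha, hb, hc, hd, he, hf, hg⟩ | ⟨j, h1, h2, ha, hb, hc, hd, he, hf, hg⟩ | ⟨j, h1, h2, ha, hb, hc, hd, he, hf, hg⟩ | ⟨h1, ha, hb, hc, hd, he, hf, hg⟩) <;>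
      (refine ⟨?_, ?_, ?_, ?_, ?_, ?_, ?_, ?_, ?_, ?_⟩ <;> omega)
  · rintro i a b c d e f g i' a' b' c' d' e' f' g' hi hi'
      (⟨j, h1, h2, ha, hb, hc, hd, he, hf, hg⟩ | ⟨j, h1, h2, ha, hb, hc, hd, he, hf, hg⟩ | ⟨j, h1, h2, ha, hb, hc, hd, he, hf, hg⟩ | ⟨h1, ha, hb, hc, hd, he, hf, hg⟩)
      (⟨j', k1, k2, ka, kb, kc, kd, ke, kf, kg⟩ | ⟨j', k1, k2, ka, kb, kc, kd, ke, kf, kg⟩ | ⟨j', k1, k2, ka, kb, kc, kd, ke, kf, kg⟩ | ⟨k1, ka, kb, kc, kd, ke, kf, kg⟩) <;>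
      subst ha hb hc hd he hf hg ka kb kc kd ke kf kg <;>
      (refine ⟨⟨?_, ?_, ?_, ?_, ?_, ?_, ?_, ?_, ?_, ?_⟩, ?_, ?_, ?_, ?_, ?_, ?_, ?_, ?_, ?_, ?_, ?_, ?_⟩ <;> omega)

/-- The explicit labelling for `p = 4 * q + 2`. -/
theorem labels_2 (q : ℕ) : HasLabels (4 * q + 2) (20 * q + 11) (20 * q + 10) := by
  apply HasLabels.of_rel (fun i a b c d e f g =>
    (∃ j, i = j ∧ i < 2 * q ∧ a = 1 + j ∧ b = 16 * q + 7 - j ∧ c = 4 * q + 2 + j ∧ d = 20 * q + 9 - j ∧ e = 16 * q + 6 - 2 * j ∧ f = 12 * q + 5 - 2 * j ∧ g = 16 * q + 7 - 2 * j) ∨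
    (∃ j, i = 2 * q + j ∧ i < 3 * q ∧ a = 6 * q + 3 + j ∧ b = 4 * q - j ∧ c = 12 * q + 8 + j ∧ d = 18 * q + 9 - j ∧ e = 2 * q + 3 + 2 * j ∧ f = 8 * q + 8 + 2 * j ∧ g = 6 * q + 1 - 2 * j) ∨
    (∃ j, i = 3 * q + j ∧ i < 4 * q ∧ a = 7 * q + 4 + j ∧ b = 3 * q - j ∧ c = 13 * q + 8 + j ∧ d = 17 * q + 8 - j ∧ e = 4 * q + 4 + 2 * j ∧ f = 10 * q + 8 + 2 * j ∧ g = 4 * q - 2 * j) ∨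
    (i = 4 * q ∧ a = 20 * q + 11 ∧ b = 12 * q + 7 ∧ c = 4 * q + 1 ∧ d = 16 * q + 8 ∧ e = 8 * q + 4 ∧ f = 8 * q + 6 ∧ g = 12 * q + 7) ∨
    (i = 4 * q + 1 ∧ a = 17 * q + 9 ∧ b = 9 * q + 4 ∧ c = 11 * q + 5 ∧ d = 7 * q + 3 ∧ e = 8 * q + 5 ∧ f = 2 * q + 1 ∧ g = 4 * q + 2))
  · intro i hi
    by_cases h0 : i < 2 * q
    · exact ⟨_, _, _, _, _, _, _, Or.inl ⟨i - (0), by omega, by omega, rfl, rfl, rfl, rfl, rfl, rfl, rfl⟩⟩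
    by_cases h1 : i < 3 * q
    · exact ⟨_, _, _, _, _, _, _, Or.inr (Or.inl ⟨i - (2 * q), by omega, by omega, rfl, rfl, rfl, rfl, rfl, rfl, rfl⟩)⟩
    by_cases h2 : i < 4 * q
    · exact ⟨_, _, _, _, _, _, _, Or.inr (Or.inr (Or.inl ⟨i - (3 * q), by omega, by omega, rfl, rfl, rfl, rfl, rfl, rfl, rfl⟩))⟩
    by_cases h3 : i < 4 * q + 1
    · exact ⟨_, _, _, _, _, _, _, Or.inr (Or.inr (Or.inr (Or.inl ⟨by omega, rfl, rfl, rfl, rfl, rfl, rfl, rfl⟩)))⟩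
    exact ⟨_, _, _, _, _, _, _, Or.inr (Or.inr (Or.inr (Or.inr (⟨by omega, rfl, rfl, rfl, rfl, rfl, rfl, rfl⟩))))⟩
  · rintro i a b c d e f g hi (⟨j, h1, h2, ha, hb, hc, hd, he, hf, hg⟩ | ⟨j, h1, h2, ha, hb, hc, hd, he, hf, hg⟩ | ⟨j, h1, h2, ha, hb, hc, hd, he, hf, hg⟩ | ⟨h1, ha, hb, hc, hd, he, hf, hg⟩ | ⟨h1, ha, hb, hc, hd, he, hf, hg⟩) <;>
      (refine ⟨?_, ?_, ?_, ?_, ?_, ?_, ?_, ?_, ?_, ?_⟩ <;> omega)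
  · rintro i a b c d e f g i' a' b' c' d' e' f' g' hi hi'
      (⟨j, h1, h2, ha, hb, hc, hd, he, hf, hg⟩ | ⟨j, h1, h2, ha, hb, hc, hd, he, hf, hg⟩ | ⟨j, h1, h2, ha, hb, hc, hd, he, hf, hg⟩ | ⟨h1, ha, hb, hc, hd, he, hf, hg⟩ | ⟨h1, ha, hb, hc, hd, he, hf, hg⟩)
      (⟨j', k1, k2, ka, kb, kc, kd, ke, kf, kg⟩ | ⟨j', k1, k2, ka, kb, kc, kd, ke, kf, kg⟩ | ⟨j', k1, k2, ka, kb, kc, kd, ke, kf, kg⟩ | ⟨k1, ka, kb, kc, kd, ke, kf, kg⟩ | ⟨k1, ka, kb, kc, kd, ke, kf, kg⟩) <;>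
      subst ha hb hc hd he hf hg ka kb kc kd ke kf kg <;>
      (refine ⟨⟨?_, ?_, ?_, ?_, ?_, ?_, ?_, ?_, ?_, ?_⟩, ?_, ?_, ?_, ?_, ?_, ?_, ?_, ?_, ?_, ?_, ?_, ?_⟩ <;> omega)

/-- The explicit labelling for `p = 4 * q + 3`. -/
theorem labels_3 (q : ℕ) : HasLabels (4 * q + 3) (20 * q + 15) (0) := by
  apply HasLabels.of_rel (fun i a b c d e f g =>
    (∃ j, i = j ∧ i < 2 * q + 1 ∧ a = 12 * q + 9 + j ∧ b = 8 * q + 6 - j ∧ c = 4 * q + 4 + j ∧ d = 16 * q + 11 - j ∧ e = 4 * q + 3 + 2 * j ∧ f = 4 * q + 2 - 2 * j ∧ g = 12 * q + 7 - 2 * j) ∨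
    (∃ j, i = 2 * q + 1 + j ∧ i < 3 * q + 1 ∧ a = 16 * q + 12 + j ∧ b = 12 * q + 8 - j ∧ c = 8 * q + 7 + j ∧ d = 20 * q + 15 - j ∧ e = 4 * q + 4 + 2 * j ∧ f = 4 * q + 1 - 2 * j ∧ g = 12 * q + 8 - 2 * j) ∨
    (∃ j, i = 3 * q + 1 + j ∧ i < 4 * q + 2 ∧ a = 17 * q + 14 + j ∧ b = 11 * q + 8 - j ∧ c = 9 * q + 7 + j ∧ d = 19 * q + 15 - j ∧ e = 6 * q + 6 + 2 * j ∧ f = 2 * q + 1 - 2 * j ∧ g = 10 * q + 8 - 2 * j) ∨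
    (i = 4 * q + 2 ∧ a = 17 * q + 13 ∧ b = 1 ∧ c = 6 * q + 5 ∧ d = 14 * q + 10 ∧ e = 17 * q + 12 ∧ f = 6 * q + 4 ∧ g = 8 * q + 5))
  · intro i hi
    by_cases h0 : i < 2 * q + 1
    · exact ⟨_, _, _, _, _, _, _, Or.inl ⟨i - (0), by omega, by omega, rfl, rfl, rfl, rfl, rfl, rfl, rfl⟩⟩
    by_cases h1 : i < 3 * q + 1
    · exact ⟨_, _, _, _, _, _, _, Or.inr (Or.inl ⟨i - (2 * q + 1), by omega, by omega, rfl, rfl, rfl, rfl, rfl, rfl, rfl⟩)⟩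
    by_cases h2 : i < 4 * q + 2
    · exact ⟨_, _, _, _, _, _, _, Or.inr (Or.inr (Or.inl ⟨i - (3 * q + 1), by omega, by omega, rfl, rfl, rfl, rfl, rfl, rfl, rfl⟩))⟩
    exact ⟨_, _, _, _, _, _, _, Or.inr (Or.inr (Or.inr (⟨by omega, rfl, rfl, rfl, rfl, rfl, rfl, rfl⟩)))⟩
  · rintro i a b c d e f g hi (⟨j, h1, h2, ha, hb, hc, hd, he, hf, hg⟩ | ⟨j, h1, h2, ha, hb, hc, hd, he, hf, hg⟩ | ⟨j, h1, h2, ha, hb, hc, hd, he, hf, hg⟩ | ⟨h1, ha, hb, hc, hd, he, hf, hg⟩) <;>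
      (refine ⟨?_, ?_, ?_, ?_, ?_, ?_, ?_, ?_, ?_, ?_⟩ <;> omega)
  · rintro i a b c d e f g i' a' b' c' d' e' f' g' hi hi'
      (⟨j, h1, h2, ha, hb, hc, hd, he, hf, hg⟩ | ⟨j, h1, h2, ha, hb, hc, hd, he, hf, hg⟩ | ⟨j, h1, h2, ha, hb, hc, hd, he, hf, hg⟩ | ⟨h1, ha, hb, hc, hd, he, hf, hg⟩)
      (⟨j', k1, k2, ka, kb, kc, kd, ke, kf, kg⟩ | ⟨j', k1, k2, ka, kb, kc, kd, ke, kf, kg⟩ | ⟨j', k1, k2, ka, kb, kc, kd, ke, kf, kg⟩ | ⟨k1, ka, kb, kc, kd, ke, kf, kg⟩) <;>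
      subst ha hb hc hd he hf hg ka kb kc kd ke kf kg <;>
      (refine ⟨⟨?_, ?_, ?_, ?_, ?_, ?_, ?_, ?_, ?_, ?_⟩, ?_, ?_, ?_, ?_, ?_, ?_, ?_, ?_, ?_, ?_, ?_, ?_⟩ <;> omega)

/-- For every positive integer `p`, the windmill `C₅ᵖ` (which has `5p` edges) is graceful
when `p ≡ 0, 3 (mod 4)` and near graceful when `p ≡ 1, 2 (mod 4)`. -/
theorem C5_windmill_graceful (p : ℕ) (hp : 1 ≤ p) :
    ((p % 4 = 0 ∨ p % 4 = 3) →
      IsGraceful (Windmill (List.replicate p 5)) (5 * p)) ∧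
    ((p % 4 = 1 ∨ p % 4 = 2) →
      IsNearGraceful (Windmill (List.replicate p 5)) (5 * p)) := by
  have key : ∃ q, p = 4 * q ∨ p = 4 * q + 1 ∨ p = 4 * q + 2 ∨ p = 4 * q + 3 :=
    ⟨p / 4, by omega⟩
  obtain ⟨q, hq⟩ := key
  constructor
  · intro h
    apply graceful_of_labels
    rcases hq with rfl | rfl | rfl | rfl
    · convert labels_0 q (by omega) using 1 <;> omega
    · omega
    · omega
    · convert labels_3 q using 1 <;> omega
  · intro h
    apply near_graceful_of_labels hp
    rcases hq with rfl | rfl | rfl | rfl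
    · omega
    · convert labels_1 q using 1 <;> omega
    · convert labels_2 q using 1 <;> omega
    · omega
end

section
/- For all integers t ≥ s ≥ 1, the variable windmill C_3^t C_4^s is graceful when t ≡ 0 or 1 (mod 4), and near graceful when t ≡ 2 or 3 (mod 4). -/
/-- `n` disjoint pairs `(p d, p d + y d)`, `1 ≤ d ≤ n`, with all members in the cells `C`. -/
def PairSys (n : ℕ) (y : ℕ → ℕ) (C : ℕ → Prop) : Prop :=
  ∃ p : ℕ → ℕ, ∀ d, 1 ≤ d → d ≤ n → C (p d) ∧ C (p d + y d) ∧
    ∀ e, 1 ≤ e → e ≤ n → p d ≠ p e + y e ∧ (p d = p e → d = e) ∧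
      (p d + y d = p e + y e → d = e)

theorem PairSys.shift {n : ℕ} {y : ℕ → ℕ} {C : ℕ → Prop} (h : PairSys n y C) (b : ℕ)
    (C' : ℕ → Prop) (hC : ∀ c, C c → C' (c + b)) : PairSys n y C' := by
  obtain ⟨p, hp⟩ := h
  refine ⟨fun d => p d + b, fun d h1 h2 => ?_⟩
  obtain ⟨ha, hb, hc⟩ := hp d h1 h2
  refine ⟨hC _ ha, ?_, fun e h3 h4 => ?_⟩
  · have := hC _ hb
    rwa [add_right_comm] at this
  · obtain ⟨h5, h6, h7⟩ := hc e h3 h4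
    refine ⟨?_, ?_, ?_⟩
    · dsimp only; omega
    · dsimp only; intro h; apply h6; omega
    · dsimp only; intro h; apply h7; omega

/-- Reflection `c ↦ b - c`. -/
theorem PairSys.reflect {n : ℕ} {y : ℕ → ℕ} {C : ℕ → Prop} (h : PairSys n y C) (b : ℕ)
    (C' : ℕ → Prop) (hC : ∀ c, C c → c ≤ b ∧ C' (b - c)) : PairSys n y C' := by
  obtain ⟨p, hp⟩ := h
  refine ⟨fun d => b - (p d + y d), fun d h1 h2 => ?_⟩
  obtain ⟨ha, hb, hc⟩ := hp d h1 h2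
  obtain ⟨ha1, ha2⟩ := hC _ ha
  obtain ⟨hb1, hb2⟩ := hC _ hb
  refine ⟨hb2, ?_, fun e h3 h4 => ?_⟩
  · have : b - (p d + y d) + y d = b - p d := by omega
    rwa [this]
  · obtain ⟨h5, h6, h7⟩ := hc e h3 h4
    obtain ⟨ha', hb', hc'⟩ := hp e h3 h4
    obtain ⟨h8, -, -⟩ := hc' d h1 h2
    obtain ⟨ha1', ha2'⟩ := hC _ ha'
    obtain ⟨hb1', hb2'⟩ := hC _ hb'
    refine ⟨?_, ?_, ?_⟩
    · dsimp only; omega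
    · dsimp only; intro h; apply h7; omega
    · dsimp only; intro h; apply h6; omega

/-- Build a system from a specification of the left ends by cases. -/
theorem PairSys.of_spec {n : ℕ} {C : ℕ → Prop} (R : ℕ → ℕ → Prop)
    (hex : ∀ d, 1 ≤ d → d ≤ n → ∃ a, R d a)
    (hC : ∀ d a, 1 ≤ d → d ≤ n → R d a → C a ∧ C (a + d))
    (hR : ∀ d a e b, 1 ≤ d → d ≤ n → 1 ≤ e → e ≤ n → R d a → R e b →
      a ≠ b + e ∧ (a = b → d = e) ∧ (a + d = b + e → d = e)) : PairSys n id C := by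
  classical
  refine ⟨fun d => if h : ∃ a, R d a then h.choose else 0, fun d h1 h2 => ?_⟩
  have key : ∀ d, 1 ≤ d → d ≤ n → R d (if h : ∃ a, R d a then h.choose else 0) := by
    intro d h1 h2
    rw [dif_pos (hex d h1 h2)]
    exact (hex d h1 h2).choose_spec
  have h3 := hC d _ h1 h2 (key d h1 h2)
  exact ⟨h3.1, h3.2, fun e h4 h5 => hR d _ e _ h1 h2 h4 h5 (key d h1 h2) (key e h4 h5)⟩

/-- A system given by a list of left ends. -/
theorem PairSys.of_list {n : ℕ} {C : ℕ → Prop} (l : List ℕ)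
    (h : ∀ d, d < n → C (l.getD d 0) ∧ C (l.getD d 0 + (d + 1)) ∧
      ∀ e, e < n → l.getD d 0 ≠ l.getD e 0 + (e + 1) ∧ (l.getD d 0 = l.getD e 0 → d = e) ∧
      (l.getD d 0 + (d + 1) = l.getD e 0 + (e + 1) → d = e)) : PairSys n id C := by
  refine ⟨fun d => l.getD (d - 1) 0, fun d h1 h2 => ?_⟩
  obtain ⟨d, rfl⟩ : ∃ d', d = d' + 1 := ⟨d - 1, by omega⟩
  obtain ⟨ha, hb, hc⟩ := h d (by omega)
  refine ⟨ha, hb, fun e h3 h4 => ?_⟩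
  obtain ⟨e, rfl⟩ : ∃ e', e = e' + 1 := ⟨e - 1, by omega⟩
  obtain ⟨h5, h6, h7⟩ := hc e (by omega)
  exact ⟨h5, fun h => by rw [h6 h], fun h => by rw [h7 h]⟩

/-- Skolem cells. -/
def SkC (n c : ℕ) : Prop := 1 ≤ c ∧ c ≤ 2 * n

/-- Hooked Skolem cells. -/
def HkC (n c : ℕ) : Prop := 1 ≤ c ∧ c ≤ 2 * n + 1 ∧ c ≠ 2 * n

/-- Doubly hooked Skolem cells. -/
def DhC (n c : ℕ) : Prop := c ≤ 2 * n + 1 ∧ c ≠ 1 ∧ c ≠ 2 * n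

instance (n c : ℕ) : Decidable (SkC n c) := by unfold SkC; infer_instance
instance (n c : ℕ) : Decidable (HkC n c) := by unfold HkC; infer_instance
instance (n c : ℕ) : Decidable (DhC n c) := by unfold DhC; infer_instance

set_option maxHeartbeats 4000000 in
theorem skolem0 (k : ℕ) (hk : 2 ≤ k) : PairSys (4 * k) id (SkC (4 * k)) := by
  apply PairSys.of_spec (fun d a =>
    (d % 2 = 0 ∧ 2 * a + d = 12 * k) ∨ (d = 4 * k - 1 ∧ a = 2 * k + 1) ∨
    (d % 2 = 1 ∧ 2 * k + 3 ≤ d ∧ d ≤ 4 * k - 3 ∧ 2 * a + d = 4 * k + 1) ∨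
    (d = 2 * k + 1 ∧ a = 1) ∨
    (d % 2 = 1 ∧ 3 ≤ d ∧ d ≤ 2 * k - 1 ∧ 2 * a + d = 4 * k + 3) ∨
    (d = 1 ∧ a = k))
  · intro d h1 h2
    by_cases c1 : d % 2 = 0
    · exact ⟨(12 * k - d) / 2, Or.inl (by omega)⟩
    by_cases c2 : d = 4 * k - 1
    · exact ⟨2 * k + 1, Or.inr (Or.inl (by omega))⟩
    by_cases c3 : 2 * k + 3 ≤ d
    · exact ⟨(4 * k + 1 - d) / 2, Or.inr (Or.inr (Or.inl (by omega)))⟩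
    by_cases c4 : d = 2 * k + 1
    · exact ⟨1, Or.inr (Or.inr (Or.inr (Or.inl (by omega))))⟩
    by_cases c5 : d = 1
    · exact ⟨k, Or.inr (Or.inr (Or.inr (Or.inr (Or.inr (by omega)))))⟩
    · exact ⟨(4 * k + 3 - d) / 2, Or.inr (Or.inr (Or.inr (Or.inr (Or.inl (by omega)))))⟩
  · intro d a h1 h2 h
    unfold SkC
    rcases h with h | h | h | h | h | h <;> omega
  · intro d a e b h1 h2 h3 h4 h h'
    rcases h with h | h | h | h | h | h <;> rcases h' with h' | h' | h' | h' | h' | h' <;>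
      refine ⟨?_, ?_, ?_⟩ <;> omega

set_option maxHeartbeats 4000000 in
theorem skolem1 (k : ℕ) (hk : 2 ≤ k) : PairSys (4 * k + 1) id (SkC (4 * k + 1)) := by
  apply PairSys.of_spec (fun d a =>
    (d % 2 = 0 ∧ 2 * a + d = 12 * k + 4) ∨ (d = 4 * k + 1 ∧ a = 2 * k + 1) ∨
    (d % 2 = 1 ∧ 2 * k + 1 ≤ d ∧ d ≤ 4 * k - 1 ∧ 2 * a + d = 4 * k + 3) ∨
    (d = 2 * k - 1 ∧ a = 1) ∨
    (d % 2 = 1 ∧ 3 ≤ d ∧ d ≤ 2 * k - 3 ∧ 2 * a + d = 4 * k + 1) ∨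
    (d = 1 ∧ a = 3 * k))
  · intro d h1 h2
    by_cases c1 : d % 2 = 0
    · exact ⟨(12 * k + 4 - d) / 2, Or.inl (by omega)⟩
    by_cases c2 : d = 4 * k + 1
    · exact ⟨2 * k + 1, Or.inr (Or.inl (by omega))⟩
    by_cases c3 : 2 * k + 1 ≤ d
    · exact ⟨(4 * k + 3 - d) / 2, Or.inr (Or.inr (Or.inl (by omega)))⟩
    by_cases c4 : d = 2 * k - 1
    · exact ⟨1, Or.inr (Or.inr (Or.inr (Or.inl (by omega))))⟩
    by_cases c5 : d = 1
    · exact ⟨3 * k, Or.inr (Or.inr (Or.inr (Or.inr (Or.inr (by omega)))))⟩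
    · exact ⟨(4 * k + 1 - d) / 2, Or.inr (Or.inr (Or.inr (Or.inr (Or.inl (by omega)))))⟩
  · intro d a h1 h2 h
    unfold SkC
    rcases h with h | h | h | h | h | h <;> omega
  · intro d a e b h1 h2 h3 h4 h h'
    rcases h with h | h | h | h | h | h <;> rcases h' with h' | h' | h' | h' | h' | h' <;>
      refine ⟨?_, ?_, ?_⟩ <;> omega

set_option maxHeartbeats 4000000 in
theorem hooked2 (k : ℕ) (hk : 2 ≤ k) : PairSys (4 * k + 2) id (HkC (4 * k + 2)) := by
  apply PairSys.of_spec (fun d a =>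
    (d % 2 = 0 ∧ 2 * a + d = 4 * k + 4) ∨ (d = 4 * k + 1 ∧ a = 2 * k + 2) ∨
    (d % 2 = 1 ∧ 2 * k + 5 ≤ d ∧ d ≤ 4 * k - 1 ∧ 2 * a + d = 12 * k + 7) ∨
    (d = 2 * k + 3 ∧ a = 6 * k + 2) ∨
    (d % 2 = 1 ∧ 3 ≤ d ∧ d ≤ 2 * k + 1 ∧ 2 * a + d = 12 * k + 5) ∨
    (d = 1 ∧ a = 7 * k + 4))
  · intro d h1 h2
    by_cases c1 : d % 2 = 0
    · exact ⟨(4 * k + 4 - d) / 2, Or.inl (by omega)⟩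
    by_cases c2 : d = 4 * k + 1
    · exact ⟨2 * k + 2, Or.inr (Or.inl (by omega))⟩
    by_cases c3 : 2 * k + 5 ≤ d
    · exact ⟨(12 * k + 7 - d) / 2, Or.inr (Or.inr (Or.inl (by omega)))⟩
    by_cases c4 : d = 2 * k + 3
    · exact ⟨6 * k + 2, Or.inr (Or.inr (Or.inr (Or.inl (by omega))))⟩
    by_cases c5 : d = 1
    · exact ⟨7 * k + 4, Or.inr (Or.inr (Or.inr (Or.inr (Or.inr (by omega)))))⟩
    · exact ⟨(12 * k + 5 - d) / 2, Or.inr (Or.inr (Or.inr (Or.inr (Or.inl (by omega)))))⟩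
  · intro d a h1 h2 h
    unfold HkC
    rcases h with h | h | h | h | h | h <;> omega
  · intro d a e b h1 h2 h3 h4 h h'
    rcases h with h | h | h | h | h | h <;> rcases h' with h' | h' | h' | h' | h' | h' <;>
      refine ⟨?_, ?_, ?_⟩ <;> omega

set_option maxHeartbeats 4000000 in
theorem hooked3 (k : ℕ) (hk : 1 ≤ k) : PairSys (4 * k + 3) id (HkC (4 * k + 3)) := by
  apply PairSys.of_spec (fun d a =>
    (d % 2 = 0 ∧ 2 * a + d = 4 * k + 4) ∨ (d = 4 * k + 3 ∧ a = 2 * k + 2) ∨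
    (d % 2 = 1 ∧ 2 * k + 3 ≤ d ∧ d ≤ 4 * k + 1 ∧ 2 * a + d = 12 * k + 9) ∨
    (d = 2 * k + 1 ∧ a = 6 * k + 6) ∨
    (d % 2 = 1 ∧ 3 ≤ d ∧ d ≤ 2 * k - 1 ∧ 2 * a + d = 12 * k + 11) ∨
    (d = 1 ∧ a = 5 * k + 4))
  · intro d h1 h2
    by_cases c1 : d % 2 = 0
    · exact ⟨(4 * k + 4 - d) / 2, Or.inl (by omega)⟩
    by_cases c2 : d = 4 * k + 3
    · exact ⟨2 * k + 2, Or.inr (Or.inl (by omega))⟩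
    by_cases c3 : 2 * k + 3 ≤ d
    · exact ⟨(12 * k + 9 - d) / 2, Or.inr (Or.inr (Or.inl (by omega)))⟩
    by_cases c4 : d = 2 * k + 1
    · exact ⟨6 * k + 6, Or.inr (Or.inr (Or.inr (Or.inl (by omega))))⟩
    by_cases c5 : d = 1
    · exact ⟨5 * k + 4, Or.inr (Or.inr (Or.inr (Or.inr (Or.inr (by omega)))))⟩
    · exact ⟨(12 * k + 11 - d) / 2, Or.inr (Or.inr (Or.inr (Or.inr (Or.inl (by omega)))))⟩
  · intro d a h1 h2 h
    unfold HkC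
    rcases h with h | h | h | h | h | h <;> omega
  · intro d a e b h1 h2 h3 h4 h h'
    rcases h with h | h | h | h | h | h <;> rcases h' with h' | h' | h' | h' | h' | h' <;>
      refine ⟨?_, ?_, ?_⟩ <;> omega

set_option maxHeartbeats 4000000 in
theorem doubly0 (k : ℕ) (hk : 4 ≤ k) : PairSys (4 * k) id (DhC (4 * k)) := by
  apply PairSys.of_spec (fun d a =>
    (d % 2 = 0 ∧ 4 ≤ d ∧ 2 * a + d = 12 * k - 2) ∨ (d = 2 ∧ a = 0) ∨
    (d % 2 = 1 ∧ 4 * k - 3 ≤ d ∧ 2 * a + d = 8 * k + 1) ∨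
    (d % 2 = 1 ∧ 2 * k + 5 ≤ d ∧ d ≤ 4 * k - 5 ∧ 2 * a + d = 4 * k + 1) ∨
    (d = 2 * k + 3 ∧ a = 6 * k - 2) ∨
    (d % 2 = 1 ∧ 3 ≤ d ∧ d ≤ 2 * k + 1 ∧ 2 * a + d = 4 * k + 3) ∨
    (d = 1 ∧ a = k - 1))
  · intro d h1 h2
    by_cases c1 : d = 2
    · exact ⟨0, Or.inr (Or.inl (by omega))⟩
    by_cases c2 : d % 2 = 0
    · exact ⟨(12 * k - 2 - d) / 2, Or.inl (by omega)⟩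
    by_cases c3 : 4 * k - 3 ≤ d
    · exact ⟨(8 * k + 1 - d) / 2, Or.inr (Or.inr (Or.inl (by omega)))⟩
    by_cases c4 : 2 * k + 5 ≤ d
    · exact ⟨(4 * k + 1 - d) / 2, Or.inr (Or.inr (Or.inr (Or.inl (by omega))))⟩
    by_cases c5 : d = 2 * k + 3
    · exact ⟨6 * k - 2, Or.inr (Or.inr (Or.inr (Or.inr (Or.inl (by omega)))))⟩
    by_cases c6 : d = 1
    · exact ⟨k - 1, Or.inr (Or.inr (Or.inr (Or.inr (Or.inr (Or.inr (by omega))))))⟩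
    · exact ⟨(4 * k + 3 - d) / 2, Or.inr (Or.inr (Or.inr (Or.inr (Or.inr (Or.inl (by omega))))))⟩
  · intro d a h1 h2 h
    unfold DhC
    rcases h with h | h | h | h | h | h | h <;> omega
  · intro d a e b h1 h2 h3 h4 h h'
    rcases h with h | h | h | h | h | h | h <;>
      rcases h' with h' | h' | h' | h' | h' | h' | h' <;>
      refine ⟨?_, ?_, ?_⟩ <;> omega

set_option maxHeartbeats 4000000 in
theorem doubly1 (k : ℕ) (hk : 3 ≤ k) : PairSys (4 * k + 1) id (DhC (4 * k + 1)) := by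
  apply PairSys.of_spec (fun d a =>
    (d % 2 = 1 ∧ 3 ≤ d ∧ 2 * a + d = 4 * k + 7) ∨ (d = 2 ∧ a = 0) ∨
    (d % 2 = 0 ∧ 4 * k - 2 ≤ d ∧ 2 * a + d = 8 * k + 6) ∨
    (d % 2 = 0 ∧ 2 * k + 4 ≤ d ∧ d ≤ 4 * k - 4 ∧ 2 * a + d = 12 * k + 6) ∨
    (d = 2 * k + 2 ∧ a = 6 * k + 1) ∨
    (d % 2 = 0 ∧ 4 ≤ d ∧ d ≤ 2 * k ∧ 2 * a + d = 12 * k + 4) ∨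
    (d = 1 ∧ a = 7 * k + 3))
  · intro d h1 h2
    by_cases c1 : d = 2
    · exact ⟨0, Or.inr (Or.inl (by omega))⟩
    by_cases c6 : d = 1
    · exact ⟨7 * k + 3, Or.inr (Or.inr (Or.inr (Or.inr (Or.inr (Or.inr (by omega))))))⟩
    by_cases c2 : d % 2 = 1
    · exact ⟨(4 * k + 7 - d) / 2, Or.inl (by omega)⟩
    by_cases c3 : 4 * k - 2 ≤ d
    · exact ⟨(8 * k + 6 - d) / 2, Or.inr (Or.inr (Or.inl (by omega)))⟩
    by_cases c4 : 2 * k + 4 ≤ d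
    · exact ⟨(12 * k + 6 - d) / 2, Or.inr (Or.inr (Or.inr (Or.inl (by omega))))⟩
    by_cases c5 : d = 2 * k + 2
    · exact ⟨6 * k + 1, Or.inr (Or.inr (Or.inr (Or.inr (Or.inl (by omega)))))⟩
    · exact ⟨(12 * k + 4 - d) / 2, Or.inr (Or.inr (Or.inr (Or.inr (Or.inr (Or.inl (by omega))))))⟩
  · intro d a h1 h2 h
    unfold DhC
    rcases h with h | h | h | h | h | h | h <;> omega
  · intro d a e b h1 h2 h3 h4 h h'
    rcases h with h | h | h | h | h | h | h <;>
      rcases h' with h' | h' | h' | h' | h' | h' | h' <;>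
      refine ⟨?_, ?_, ?_⟩ <;> omega

set_option maxRecDepth 10000 in
theorem skolem (n : ℕ) (h0 : 1 ≤ n) (h : n % 4 = 0 ∨ n % 4 = 1) : PairSys n id (SkC n) := by
  by_cases c1 : n = 1
  · subst c1
    exact PairSys.of_list (n := 1) (C := SkC 1) [1] (by decide)
  by_cases c4 : n = 4
  · subst c4
    exact PairSys.of_list (n := 4) (C := SkC 4) [1, 5, 3, 4] (by decide)
  by_cases c5 : n = 5
  · subst c5
    exact PairSys.of_list (n := 5) (C := SkC 5) [1, 7, 3, 4, 5] (by decide)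
  rcases h with h | h
  · obtain ⟨k, rfl⟩ : ∃ k, n = 4 * k := ⟨n / 4, by omega⟩
    exact skolem0 k (by omega)
  · obtain ⟨k, rfl⟩ : ∃ k, n = 4 * k + 1 := ⟨n / 4, by omega⟩
    exact skolem1 k (by omega)

set_option maxRecDepth 10000 in
theorem hooked (n : ℕ) (h : n % 4 = 2 ∨ n % 4 = 3) : PairSys n id (HkC n) := by
  by_cases c2 : n = 2
  · subst c2
    exact PairSys.of_list (n := 2) (C := HkC 2) [1, 3] (by decide)
  by_cases c6 : n = 6
  · subst c6
    exact PairSys.of_list (n := 6) (C := HkC 6) [2, 7, 1, 6, 8, 5] (by decide)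
  by_cases c3 : n = 3
  · subst c3
    exact PairSys.of_list (n := 3) (C := HkC 3) [1, 3, 4] (by decide)
  rcases h with h | h
  · obtain ⟨k, rfl⟩ : ∃ k, n = 4 * k + 2 := ⟨n / 4, by omega⟩
    exact hooked2 k (by omega)
  · obtain ⟨k, rfl⟩ : ∃ k, n = 4 * k + 3 := ⟨n / 4, by omega⟩
    exact hooked3 k (by omega)

set_option maxRecDepth 10000 in
theorem doubly (n : ℕ) (h0 : 2 ≤ n) (h : n % 4 = 0 ∨ n % 4 = 1) : PairSys n id (DhC n) := by
  by_cases c4 : n = 4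
  · subst c4
    exact PairSys.of_list (n := 4) (C := DhC 4) [2, 5, 6, 0] (by decide)
  by_cases c8 : n = 8
  · subst c8
    exact PairSys.of_list (n := 8) (C := DhC 8) [9, 15, 0, 2, 8, 5, 7, 4] (by decide)
  by_cases c12 : n = 12
  · subst c12
    exact PairSys.of_list (n := 12) (C := DhC 12) [4, 0, 3, 11, 20, 10, 14, 9, 13, 8, 12, 7] (by decide)
  by_cases c5 : n = 5
  · subst c5
    exact PairSys.of_list (n := 5) (C := DhC 5) [4, 0, 6, 7, 3] (by decide)
  by_cases c9 : n = 9
  · subst c9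
    exact PairSys.of_list (n := 9) (C := DhC 9) [3, 0, 8, 15, 7, 10, 6, 9, 5] (by decide)
  rcases h with h | h
  · obtain ⟨k, rfl⟩ : ∃ k, n = 4 * k := ⟨n / 4, by omega⟩
    exact doubly0 k (by omega)
  · obtain ⟨k, rfl⟩ : ∃ k, n = 4 * k + 1 := ⟨n / 4, by omega⟩
    exact doubly1 k (by omega)

/-- The `c`-th vertex on the closed walk around the `i`-th vane. -/
def vert (L : List ℕ) (i : Fin L.length) (c : ℕ) : WindmillVertex L :=
  if h : 1 ≤ c ∧ c < L.get i then some ⟨i, ⟨c - 1, by omega⟩⟩ else none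

/-- A labelling from a numerical function, with the centre labelled `0`. -/
def labOf (L : List ℕ) (F : ℕ → ℕ → ℕ) : WindmillVertex L → ℕ
  | none => 0
  | some ⟨i, j⟩ => F i.val j.val

theorem labOf_vert (L : List ℕ) (F : ℕ → ℕ → ℕ) (i : Fin L.length) (c : ℕ) :
    labOf L F (vert L i c) = if 1 ≤ c ∧ c < L.get i then F i.val (c - 1) else 0 := by
  unfold vert
  split_ifs with h <;> rfl

theorem windmill_rel_edge (L : List ℕ) (hL : ∀ i, 3 ≤ L.get i) (v w : WindmillVertex L)
    (h : windmillRel L v w) :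
    ∃ (i : Fin L.length) (c : ℕ), c < L.get i ∧ s(v, w) = s(vert L i c, vert L i (c + 1)) := by
  rcases v with _ | ⟨i, j⟩ <;> rcases w with _ | ⟨i', j'⟩
  · exact h.elim
  · have hj := j'.2
    have h3 := hL i'
    have h : j'.val = 0 ∨ j'.val + 2 = L.get i' := h
    rcases h with h | h
    · refine ⟨i', 0, by omega, ?_⟩
      have e1 : vert L i' 0 = none := by
        unfold vert; rw [dif_neg (by omega)]
      have e2 : vert L i' (0 + 1) = some ⟨i', j'⟩ := by
        unfold vert; rw [dif_pos (by omega)]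
        congr; simp [h]
      rw [e1, e2]
    · refine ⟨i', j'.val + 1, by omega, ?_⟩
      have e1 : vert L i' (j'.val + 1 + 1) = none := by
        unfold vert; rw [dif_neg (by omega)]
      have e2 : vert L i' (j'.val + 1) = some ⟨i', j'⟩ := by
        unfold vert; rw [dif_pos (by omega)]
        rfl
      rw [e1, e2, Sym2.eq_swap]
  · exact h.elim
  · have h : i.val = i'.val ∧ j'.val = j.val + 1 := h
    obtain ⟨h1, h2⟩ := h
    have h1 : i = i' := Fin.ext h1
    subst h1
    have hj := j'.2
    refine ⟨i, j.val + 1, by omega, ?_⟩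
    have e1 : vert L i (j.val + 1) = some ⟨i, j⟩ := by
      unfold vert; rw [dif_pos (by omega)]; rfl
    have e2 : vert L i (j.val + 1 + 1) = some ⟨i, j'⟩ := by
      unfold vert; rw [dif_pos (by omega)]
      congr; simp [h2]
    rw [e1, e2]

theorem windmill_edge (L : List ℕ) (hL : ∀ i, 3 ≤ L.get i) (e : Sym2 (WindmillVertex L)) :
    e ∈ (Windmill L).edgeSet ↔
    ∃ (i : Fin L.length) (c : ℕ), c < L.get i ∧ e = s(vert L i c, vert L i (c + 1)) := by
  constructor
  · induction e using Sym2.ind with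
    | _ v w =>
      intro h
      rw [SimpleGraph.mem_edgeSet] at h
      unfold Windmill at h
      rw [SimpleGraph.fromRel_adj] at h
      rcases h.2 with h | h
      · exact windmill_rel_edge L hL v w h
      · rw [Sym2.eq_swap]
        exact windmill_rel_edge L hL w v h
  · rintro ⟨i, c, hc, rfl⟩
    rw [SimpleGraph.mem_edgeSet]
    unfold Windmill
    rw [SimpleGraph.fromRel_adj]
    have h3 := hL i
    by_cases c0 : c = 0
    · subst c0
      have e1 : vert L i 0 = none := by
        unfold vert; rw [dif_neg (by omega)]
      have e2 : vert L i (0 + 1) = some ⟨i, ⟨0, by omega⟩⟩ := by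
        unfold vert; rw [dif_pos (by omega)]
      rw [e1, e2]
      exact ⟨by simp, Or.inl (Or.inl rfl)⟩
    · have e1 : vert L i c = some ⟨i, ⟨c - 1, by omega⟩⟩ := by
        unfold vert; rw [dif_pos (by omega)]
      by_cases c1 : c + 1 = L.get i
      · have e2 : vert L i (c + 1) = none := by
          unfold vert; rw [dif_neg (by omega)]
        rw [e1, e2]
        refine ⟨by simp, Or.inr (Or.inr ?_)⟩
        change c - 1 + 2 = L.get i
        omega
      · have e2 : vert L i (c + 1) = some ⟨i, ⟨c, by omega⟩⟩ := by
          unfold vert; rw [dif_pos (by omega)]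
          rfl
        rw [e1, e2]
        refine ⟨?_, Or.inl ⟨rfl, ?_⟩⟩
        · intro h
          simp only [Option.some.injEq, Sigma.mk.injEq, heq_eq_eq, Fin.mk.injEq, true_and] at h
          omega
        · change c = c - 1 + 1
          omega

/-- Reduction to arithmetic. -/
theorem windmill_bijOn (L : List ℕ) (hL : ∀ i, 3 ≤ L.get i) (F G : ℕ → ℕ → ℕ) (T : Finset ℕ)
    (hT : T.card = L.sum)
    (hG : ∀ (i : Fin L.length) (c : ℕ), c < L.get i →
      edgeLabel (labOf L F) s(vert L i c, vert L i (c + 1)) = G i c)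
    (hGT : ∀ (i : Fin L.length) (c : ℕ), c < L.get i → G i c ∈ T)
    (hGi : ∀ (i i' : Fin L.length) (c c' : ℕ), c < L.get i → c' < L.get i' → G i c = G i' c' →
      i = i' ∧ c = c') :
    Set.BijOn (edgeLabel (labOf L F)) (Windmill L).edgeSet (T : Set ℕ) := by
  refine ⟨?_, ?_, ?_⟩
  · intro e he
    obtain ⟨i, c, hc, rfl⟩ := (windmill_edge L hL e).1 he
    rw [hG i c hc]
    exact hGT i c hc
  · intro e he e' he' h
    obtain ⟨i, c, hc, rfl⟩ := (windmill_edge L hL e).1 he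
    obtain ⟨i', c', hc', rfl⟩ := (windmill_edge L hL e').1 he'
    rw [hG i c hc, hG i' c' hc'] at h
    obtain ⟨rfl, rfl⟩ := hGi i i' c c' hc hc' h
    rfl
  · let g : (Σ i : Fin L.length, Fin (L.get i)) → ℕ := fun q => G q.1 q.2
    have gi : Function.Injective g := by
      rintro ⟨i, c⟩ ⟨i', c'⟩ h
      obtain ⟨rfl, h2⟩ := hGi i i' c c' c.2 c'.2 h
      have := Fin.ext h2
      rw [this]
    have himg : Finset.univ.image g = T := by
      apply Finset.eq_of_subset_of_card_le
      · intro x hx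
        obtain ⟨q, -, rfl⟩ := Finset.mem_image.1 hx
        exact hGT q.1 q.2 q.2.2
      · rw [Finset.card_image_of_injective _ gi, hT, Finset.card_univ, Fintype.card_sigma]
        simp
    intro x hx
    have hx : x ∈ Finset.univ.image g := by rw [himg]; exact hx
    obtain ⟨⟨i, c⟩, -, rfl⟩ := Finset.mem_image.1 hx
    exact ⟨_, (windmill_edge L hL _).2 ⟨i, c, c.2, rfl⟩, hG i c c.2⟩

theorem labOf_injective (L : List ℕ) (F : ℕ → ℕ → ℕ)
    (h0 : ∀ (i : Fin L.length) (j : ℕ), j < L.get i - 1 → F i j ≠ 0)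
    (hF : ∀ (i i' : Fin L.length) (j j' : ℕ), j < L.get i - 1 → j' < L.get i' - 1 →
      F i j = F i' j' → i = i' ∧ j = j') : Function.Injective (labOf L F) := by
  rintro (_ | ⟨i, j⟩) (_ | ⟨i', j'⟩) h
  · rfl
  · exact (h0 i' j' j'.2 h.symm).elim
  · exact (h0 i j j.2 h).elim
  · obtain ⟨rfl, h2⟩ := hF i i' j j' j.2 j'.2 h
    have := Fin.ext h2
    rw [this]

set_option maxHeartbeats 4000000 in
theorem windmill_key (t s : ℕ) (y : ℕ → ℕ) (T : Finset ℕ) (hT : T.card = 2 * t + 4 * s)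
    (hTt : ∀ c ∈ T, t < c) (A B C : ℕ → Prop) (hA : PairSys t id A) (hB : PairSys s y B)
    (hC : PairSys s y C) (hAT : ∀ c, A c → c ∈ T) (hBT : ∀ c, B c → c ∈ T)
    (hCT : ∀ c, C c → c ∈ T) (hAB : ∀ c, A c → B c → False) (hAC : ∀ c, A c → C c → False)
    (hBC : ∀ c, B c → C c → False) (hy : ∀ j, 1 ≤ j → j ≤ s → 1 ≤ y j ∧ y j ≤ t)
    (hyi : ∀ j k, 1 ≤ j → j ≤ s → 1 ≤ k → k ≤ s → y j = y k → j = k) :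
    ∃ f : WindmillVertex (List.replicate t 3 ++ List.replicate s 4) → ℕ,
      Function.Injective f ∧ (∀ v, f v ≤ t ∨ f v ∈ T) ∧
      Set.BijOn (edgeLabel f) (Windmill (List.replicate t 3 ++ List.replicate s 4)).edgeSet
        ((Finset.Icc 1 t ∪ T : Finset ℕ) : Set ℕ) := by
  obtain ⟨p, hp⟩ := hA
  obtain ⟨q, hq⟩ := hB
  obtain ⟨r, hr⟩ := hC
  set L := List.replicate t 3 ++ List.replicate s 4 with hLdef
  have hlen : L.length = t + s := by simp [hLdef]
  have hsum : L.sum = 3 * t + 4 * s := by simp [hLdef]; ring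
  have hg1 : ∀ i : Fin L.length, i.val < t → L.get i = 3 := by
    intro i hi
    simp [hLdef, List.getElem_append, hi]
  have hg2 : ∀ i : Fin L.length, ¬ i.val < t → L.get i = 4 := by
    intro i hi
    simp [hLdef, List.getElem_append, hi]
  have hL3 : ∀ i, 3 ≤ L.get i := by
    intro i
    by_cases h : i.val < t
    · rw [hg1 i h]
    · rw [hg2 i h]; omega
  let F : ℕ → ℕ → ℕ := fun i j => if i < t then (if j = 0 then p (i + 1) else p (i + 1) + (i + 1))
    else (if j = 0 then q (i - t + 1) + y (i - t + 1) else if j = 1 then y (i - t + 1)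
      else r (i - t + 1) + y (i - t + 1))
  let G : ℕ → ℕ → ℕ := fun i c => if i < t then
      (if c = 0 then p (i + 1) else if c = 1 then i + 1 else p (i + 1) + (i + 1))
    else (if c = 0 then q (i - t + 1) + y (i - t + 1) else if c = 1 then q (i - t + 1)
      else if c = 2 then r (i - t + 1) else r (i - t + 1) + y (i - t + 1))
  -- elementary facts
  have pT : ∀ i, i < t → p (i + 1) ∈ T ∧ p (i + 1) + (i + 1) ∈ T ∧ t < p (i + 1) := by
    intro i hi
    obtain ⟨h1, h2, -⟩ := hp (i + 1) (by omega) (by omega)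
    exact ⟨hAT _ h1, hAT _ h2, hTt _ (hAT _ h1)⟩
  have qT : ∀ i, i < s → q (i + 1) ∈ T ∧ q (i + 1) + y (i + 1) ∈ T ∧ t < q (i + 1) := by
    intro i hi
    obtain ⟨h1, h2, -⟩ := hq (i + 1) (by omega) (by omega)
    exact ⟨hBT _ h1, hBT _ h2, hTt _ (hBT _ h1)⟩
  have rT : ∀ i, i < s → r (i + 1) ∈ T ∧ r (i + 1) + y (i + 1) ∈ T ∧ t < r (i + 1) := by
    intro i hi
    obtain ⟨h1, h2, -⟩ := hr (i + 1) (by omega) (by omega)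
    exact ⟨hCT _ h1, hCT _ h2, hTt _ (hCT _ h1)⟩
  have pp : ∀ i j, i < t → j < t → p (i + 1) ≠ p (j + 1) + (j + 1) ∧
      p (j + 1) ≠ p (i + 1) + (i + 1) ∧ (p (i + 1) = p (j + 1) → i = j) ∧
      (p (i + 1) + (i + 1) = p (j + 1) + (j + 1) → i = j) := by
    intro i j hi hj
    obtain ⟨a1, a2, a3⟩ := (hp (i + 1) (by omega) (by omega)).2.2 (j + 1) (by omega) (by omega)
    obtain ⟨b1, -, -⟩ := (hp (j + 1) (by omega) (by omega)).2.2 (i + 1) (by omega) (by omega)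
    exact ⟨a1, b1, fun h => by have := a2 h; omega, fun h => by have := a3 h; omega⟩
  have qq : ∀ i j, i < s → j < s → q (i + 1) ≠ q (j + 1) + y (j + 1) ∧
      q (j + 1) ≠ q (i + 1) + y (i + 1) ∧ (q (i + 1) = q (j + 1) → i = j) ∧
      (q (i + 1) + y (i + 1) = q (j + 1) + y (j + 1) → i = j) := by
    intro i j hi hj
    obtain ⟨a1, a2, a3⟩ := (hq (i + 1) (by omega) (by omega)).2.2 (j + 1) (by omega) (by omega)
    obtain ⟨b1, -, -⟩ := (hq (j + 1) (by omega) (by omega)).2.2 (i + 1) (by omega) (by omega)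
    exact ⟨a1, b1, fun h => by have := a2 h; omega, fun h => by have := a3 h; omega⟩
  have rr : ∀ i j, i < s → j < s → r (i + 1) ≠ r (j + 1) + y (j + 1) ∧
      r (j + 1) ≠ r (i + 1) + y (i + 1) ∧ (r (i + 1) = r (j + 1) → i = j) ∧
      (r (i + 1) + y (i + 1) = r (j + 1) + y (j + 1) → i = j) := by
    intro i j hi hj
    obtain ⟨a1, a2, a3⟩ := (hr (i + 1) (by omega) (by omega)).2.2 (j + 1) (by omega) (by omega)
    obtain ⟨b1, -, -⟩ := (hr (j + 1) (by omega) (by omega)).2.2 (i + 1) (by omega) (by omega)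
    exact ⟨a1, b1, fun h => by have := a2 h; omega, fun h => by have := a3 h; omega⟩
  have pq : ∀ i j, i < t → j < s → p (i + 1) ≠ q (j + 1) ∧ p (i + 1) ≠ q (j + 1) + y (j + 1) ∧
      p (i + 1) + (i + 1) ≠ q (j + 1) ∧ p (i + 1) + (i + 1) ≠ q (j + 1) + y (j + 1) := by
    intro i j hi hj
    obtain ⟨a1, a2, -⟩ := hp (i + 1) (by omega) (by omega)
    obtain ⟨b1, b2, -⟩ := hq (j + 1) (by omega) (by omega)
    exact ⟨fun h => hAB _ a1 (h ▸ b1), fun h => hAB _ a1 (h ▸ b2), fun h => hAB _ a2 (h ▸ b1),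
      fun h => hAB _ a2 (h ▸ b2)⟩
  have pr : ∀ i j, i < t → j < s → p (i + 1) ≠ r (j + 1) ∧ p (i + 1) ≠ r (j + 1) + y (j + 1) ∧
      p (i + 1) + (i + 1) ≠ r (j + 1) ∧ p (i + 1) + (i + 1) ≠ r (j + 1) + y (j + 1) := by
    intro i j hi hj
    obtain ⟨a1, a2, -⟩ := hp (i + 1) (by omega) (by omega)
    obtain ⟨b1, b2, -⟩ := hr (j + 1) (by omega) (by omega)
    exact ⟨fun h => hAC _ a1 (h ▸ b1), fun h => hAC _ a1 (h ▸ b2), fun h => hAC _ a2 (h ▸ b1),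
      fun h => hAC _ a2 (h ▸ b2)⟩
  have qr : ∀ i j, i < s → j < s → q (i + 1) ≠ r (j + 1) ∧ q (i + 1) ≠ r (j + 1) + y (j + 1) ∧
      q (i + 1) + y (i + 1) ≠ r (j + 1) ∧ q (i + 1) + y (i + 1) ≠ r (j + 1) + y (j + 1) := by
    intro i j hi hj
    obtain ⟨a1, a2, -⟩ := hq (i + 1) (by omega) (by omega)
    obtain ⟨b1, b2, -⟩ := hr (j + 1) (by omega) (by omega)
    exact ⟨fun h => hBC _ a1 (h ▸ b1), fun h => hBC _ a1 (h ▸ b2), fun h => hBC _ a2 (h ▸ b1),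
      fun h => hBC _ a2 (h ▸ b2)⟩
  have yT : ∀ i, i < s → 1 ≤ y (i + 1) ∧ y (i + 1) ≤ t := fun i hi => hy _ (by omega) (by omega)
  have yy : ∀ i j, i < s → j < s → y (i + 1) = y (j + 1) → i = j := by
    intro i j hi hj h
    have := hyi (i + 1) (j + 1) (by omega) (by omega) (by omega) (by omega) h
    omega
  -- values of the auxiliary functions
  have F1 : ∀ i j, i < t → F i j = if j = 0 then p (i + 1) else p (i + 1) + (i + 1) :=
    fun i j hi => if_pos hi
  have F2 : ∀ i j, ¬ i < t → F i j = if j = 0 then q (i - t + 1) + y (i - t + 1)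
      else if j = 1 then y (i - t + 1) else r (i - t + 1) + y (i - t + 1) :=
    fun i j hi => if_neg hi
  have G1 : ∀ i c, i < t → G i c =
      if c = 0 then p (i + 1) else if c = 1 then i + 1 else p (i + 1) + (i + 1) :=
    fun i j hi => if_pos hi
  have G2 : ∀ i c, ¬ i < t → G i c = if c = 0 then q (i - t + 1) + y (i - t + 1)
      else if c = 1 then q (i - t + 1)
      else if c = 2 then r (i - t + 1) else r (i - t + 1) + y (i - t + 1) :=
    fun i j hi => if_neg hi
  clear_value F G
  refine ⟨labOf L F, ?_, ?_, ?_⟩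
  · apply labOf_injective
    · intro i j hj
      have hi := i.2
      by_cases h : i.val < t
      · have := pT i h
        rw [F1 _ _ h]
        split_ifs <;> omega
      · have := qT (i - t) (by omega)
        have := rT (i - t) (by omega)
        have := yT (i - t) (by omega)
        rw [F2 _ _ h]
        split_ifs <;> omega
    · intro i i' j j' hj hj' h
      have hi := i.2
      have hi' := i'.2
      suffices i.val = i'.val ∧ j = j' from ⟨Fin.ext this.1, this.2⟩
      by_cases c1 : i.val < t <;> by_cases c2 : i'.val < t
      · rw [F1 _ _ c1, F1 _ _ c2] at h
        rw [hg1 _ c1] at hj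
        rw [hg1 _ c2] at hj'
        have := pp i i' c1 c2
        split_ifs at h <;> omega
      · rw [F1 _ _ c1, F2 _ _ c2] at h
        have := pq i (i' - t) c1 (by omega)
        have := pr i (i' - t) c1 (by omega)
        have := yT (i' - t) (by omega)
        have := pT i c1
        split_ifs at h <;> omega
      · rw [F2 _ _ c1, F1 _ _ c2] at h
        have := pq i' (i - t) c2 (by omega)
        have := pr i' (i - t) c2 (by omega)
        have := yT (i - t) (by omega)
        have := pT i' c2
        split_ifs at h <;> omega
      · rw [F2 _ _ c1, F2 _ _ c2] at h
        rw [hg2 _ c1] at hj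
        rw [hg2 _ c2] at hj'
        obtain ⟨a1, a2, a3, a4⟩ := qq (i - t) (i' - t) (by omega) (by omega)
        obtain ⟨b1, b2, b3, b4⟩ := rr (i - t) (i' - t) (by omega) (by omega)
        obtain ⟨z1, z2, z3, z4⟩ := qr (i - t) (i' - t) (by omega) (by omega)
        obtain ⟨d1, d2, d3, d4⟩ := qr (i' - t) (i - t) (by omega) (by omega)
        have y1 := yy (i - t) (i' - t) (by omega) (by omega)
        have := yT (i - t) (by omega)
        have := yT (i' - t) (by omega)
        have := qT (i - t) (by omega)
        have := qT (i' - t) (by omega)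
        have := rT (i - t) (by omega)
        have := rT (i' - t) (by omega)
        split_ifs at h
        all_goals first
          | exact absurd h a1
          | exact absurd h.symm a1
          | exact absurd h a2
          | exact absurd h.symm a2
          | exact absurd h b1
          | exact absurd h.symm b1
          | exact absurd h b2
          | exact absurd h.symm b2
          | exact absurd h z1
          | exact absurd h z2
          | exact absurd h z3
          | exact absurd h z4
          | exact absurd h.symm d1
          | exact absurd h.symm d2
          | exact absurd h.symm d3
          | exact absurd h.symm d4
          | (have := a3 h; clear a1 a2 a3 a4 b1 b2 b3 b4 z1 z2 z3 z4 d1 d2 d3 d4; omega)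
          | (have := a4 h; clear a1 a2 a3 a4 b1 b2 b3 b4 z1 z2 z3 z4 d1 d2 d3 d4; omega)
          | (have := b3 h; clear a1 a2 a3 a4 b1 b2 b3 b4 z1 z2 z3 z4 d1 d2 d3 d4; omega)
          | (have := b4 h; clear a1 a2 a3 a4 b1 b2 b3 b4 z1 z2 z3 z4 d1 d2 d3 d4; omega)
          | (have := y1 h; clear a1 a2 a3 a4 b1 b2 b3 b4 z1 z2 z3 z4 d1 d2 d3 d4; omega)
          | (clear a1 a2 a3 a4 b1 b2 b3 b4 z1 z2 z3 z4 d1 d2 d3 d4 y1; omega)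
  · rintro (_ | ⟨i, j⟩)
    · left; exact Nat.zero_le _
    · change F i j ≤ t ∨ F i j ∈ T
      have hi := i.2
      by_cases h : i.val < t
      · have := pT i h
        rw [F1 _ _ h]
        split_ifs
        · exact Or.inr this.1
        · exact Or.inr this.2.1
      · have h1 := qT (i - t) (by omega)
        have h2 := rT (i - t) (by omega)
        have h3 := yT (i - t) (by omega)
        rw [F2 _ _ h]
        split_ifs
        · exact Or.inr h1.2.1
        · exact Or.inl h3.2
        · exact Or.inr h2.2.1
  · apply windmill_bijOn L hL3 F G
    · rw [Finset.card_union_of_disjoint, hT, hsum, Nat.card_Icc]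
      · omega
      · rw [Finset.disjoint_left]
        intro c h1 h2
        have := hTt c h2
        rw [Finset.mem_Icc] at h1
        omega
    · intro i c hc
      change ((labOf L F (vert L i c) : ℤ) - (labOf L F (vert L i (c + 1)) : ℤ)).natAbs = _
      rw [labOf_vert, labOf_vert]
      have hi := i.2
      by_cases h : i.val < t
      · rw [hg1 _ h] at hc ⊢
        have := pT i h
        rw [F1 _ _ h, F1 _ _ h, G1 _ _ h]
        obtain rfl | rfl | rfl : c = 0 ∨ c = 1 ∨ c = 2 := by omega
        all_goals simp
        all_goals omega
      · rw [hg2 _ h] at hc ⊢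
        rw [F2 _ _ h, F2 _ _ h, G2 _ _ h]
        obtain rfl | rfl | rfl | rfl : c = 0 ∨ c = 1 ∨ c = 2 ∨ c = 3 := by omega
        all_goals simp
        all_goals omega
    · intro i c hc
      have hi := i.2
      rw [Finset.mem_union, Finset.mem_Icc]
      by_cases h : i.val < t
      · have := pT i h
        rw [G1 _ _ h]
        split_ifs
        · exact Or.inr this.1
        · left; omega
        · exact Or.inr this.2.1
      · have h1 := qT (i - t) (by omega)
        have h2 := rT (i - t) (by omega)
        rw [G2 _ _ h]
        split_ifs
        · exact Or.inr h1.2.1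
        · exact Or.inr h1.1
        · exact Or.inr h2.1
        · exact Or.inr h2.2.1
    · intro i i' j j' hj hj' h
      have hi := i.2
      have hi' := i'.2
      suffices i.val = i'.val ∧ j = j' from ⟨Fin.ext this.1, this.2⟩
      by_cases c1 : i.val < t <;> by_cases c2 : i'.val < t
      · rw [G1 _ _ c1, G1 _ _ c2] at h
        rw [hg1 _ c1] at hj
        rw [hg1 _ c2] at hj'
        have := pp i i' c1 c2
        have := pT i c1
        have := pT i' c2
        split_ifs at h <;> omega
      · rw [G1 _ _ c1, G2 _ _ c2] at h
        have := pq i (i' - t) c1 (by omega)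
        have := pr i (i' - t) c1 (by omega)
        have := qT (i' - t) (by omega)
        have := rT (i' - t) (by omega)
        split_ifs at h <;> omega
      · rw [G2 _ _ c1, G1 _ _ c2] at h
        have := pq i' (i - t) c2 (by omega)
        have := pr i' (i - t) c2 (by omega)
        have := qT (i - t) (by omega)
        have := rT (i - t) (by omega)
        split_ifs at h <;> omega
      · rw [G2 _ _ c1, G2 _ _ c2] at h
        rw [hg2 _ c1] at hj
        rw [hg2 _ c2] at hj'
        obtain ⟨a1, a2, a3, a4⟩ := qq (i - t) (i' - t) (by omega) (by omega)
        obtain ⟨b1, b2, b3, b4⟩ := rr (i - t) (i' - t) (by omega) (by omega)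
        obtain ⟨z1, z2, z3, z4⟩ := qr (i - t) (i' - t) (by omega) (by omega)
        obtain ⟨d1, d2, d3, d4⟩ := qr (i' - t) (i - t) (by omega) (by omega)
        split_ifs at h
        all_goals first
          | exact absurd h a1
          | exact absurd h.symm a1
          | exact absurd h a2
          | exact absurd h.symm a2
          | exact absurd h b1
          | exact absurd h.symm b1
          | exact absurd h b2
          | exact absurd h.symm b2
          | exact absurd h z1
          | exact absurd h z2
          | exact absurd h z3
          | exact absurd h z4
          | exact absurd h.symm d1
          | exact absurd h.symm d2
          | exact absurd h.symm d3
          | exact absurd h.symm d4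
          | (have := a3 h; clear a1 a2 a3 a4 b1 b2 b3 b4 z1 z2 z3 z4 d1 d2 d3 d4; omega)
          | (have := a4 h; clear a1 a2 a3 a4 b1 b2 b3 b4 z1 z2 z3 z4 d1 d2 d3 d4; omega)
          | (have := b3 h; clear a1 a2 a3 a4 b1 b2 b3 b4 z1 z2 z3 z4 d1 d2 d3 d4; omega)
          | (have := b4 h; clear a1 a2 a3 a4 b1 b2 b3 b4 z1 z2 z3 z4 d1 d2 d3 d4; omega)


theorem windmill_graceful_aux (t s : ℕ) (y : ℕ → ℕ) (A B C : ℕ → Prop)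
    (hA : PairSys t id A) (hB : PairSys s y B) (hC : PairSys s y C)
    (hAT : ∀ c, A c → t < c ∧ c ≤ 3 * t + 4 * s) (hBT : ∀ c, B c → t < c ∧ c ≤ 3 * t + 4 * s)
    (hCT : ∀ c, C c → t < c ∧ c ≤ 3 * t + 4 * s)
    (hAB : ∀ c, A c → B c → False) (hAC : ∀ c, A c → C c → False)
    (hBC : ∀ c, B c → C c → False) (hy : ∀ j, 1 ≤ j → j ≤ s → 1 ≤ y j ∧ y j ≤ t)
    (hyi : ∀ j k, 1 ≤ j → j ≤ s → 1 ≤ k → k ≤ s → y j = y k → j = k) :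
    IsGraceful (Windmill (List.replicate t 3 ++ List.replicate s 4)) (3 * t + 4 * s) := by
  obtain ⟨f, h1, h2, h3⟩ := windmill_key t s y (Finset.Icc (t + 1) (3 * t + 4 * s))
    (by rw [Nat.card_Icc]; omega) (fun c hc => by rw [Finset.mem_Icc] at hc; omega) A B C hA hB hC
    (fun c hc => by have := hAT c hc; rw [Finset.mem_Icc]; omega)
    (fun c hc => by have := hBT c hc; rw [Finset.mem_Icc]; omega)
    (fun c hc => by have := hCT c hc; rw [Finset.mem_Icc]; omega) hAB hAC hBC hy hyi
  refine ⟨f, h1, fun v => ?_, ?_⟩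
  · have := h2 v
    rw [Finset.mem_Icc] at this
    omega
  · convert h3 using 1
    ext c
    simp only [Set.mem_Icc, Finset.coe_union, Finset.coe_Icc, Set.mem_union]
    omega

theorem windmill_near_aux (t s : ℕ) (hs : 1 ≤ s) (y : ℕ → ℕ) (A B C : ℕ → Prop)
    (hA : PairSys t id A) (hB : PairSys s y B) (hC : PairSys s y C)
    (hAT : ∀ c, A c → t < c ∧ c ≤ 3 * t + 4 * s + 1 ∧ c ≠ 3 * t + 4 * s)
    (hBT : ∀ c, B c → t < c ∧ c ≤ 3 * t + 4 * s + 1 ∧ c ≠ 3 * t + 4 * s)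
    (hCT : ∀ c, C c → t < c ∧ c ≤ 3 * t + 4 * s + 1 ∧ c ≠ 3 * t + 4 * s)
    (hAB : ∀ c, A c → B c → False) (hAC : ∀ c, A c → C c → False)
    (hBC : ∀ c, B c → C c → False) (hy : ∀ j, 1 ≤ j → j ≤ s → 1 ≤ y j ∧ y j ≤ t)
    (hyi : ∀ j k, 1 ≤ j → j ≤ s → 1 ≤ k → k ≤ s → y j = y k → j = k) :
    IsNearGraceful (Windmill (List.replicate t 3 ++ List.replicate s 4)) (3 * t + 4 * s) := by
  have hm : ∀ c, c ∈ (Finset.Icc (t + 1) (3 * t + 4 * s + 1)).erase (3 * t + 4 * s) ↔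
      t < c ∧ c ≤ 3 * t + 4 * s + 1 ∧ c ≠ 3 * t + 4 * s := by
    intro c
    rw [Finset.mem_erase, Finset.mem_Icc]
    omega
  obtain ⟨f, h1, h2, h3⟩ := windmill_key t s y
    ((Finset.Icc (t + 1) (3 * t + 4 * s + 1)).erase (3 * t + 4 * s))
    (by
      rw [Finset.card_erase_of_mem (by rw [Finset.mem_Icc]; omega), Nat.card_Icc]; omega)
    (fun c hc => by rw [hm] at hc; omega) A B C hA hB hC
    (fun c hc => (hm c).2 (hAT c hc))
    (fun c hc => (hm c).2 (hBT c hc))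
    (fun c hc => (hm c).2 (hCT c hc)) hAB hAC hBC hy hyi
  refine ⟨f, h1, fun v => ?_, Or.inr ?_⟩
  · have := h2 v
    rw [hm] at this
    omega
  · convert h3 using 1
    ext c
    rw [Finset.mem_coe, Finset.mem_union, hm, Finset.mem_Icc]
    simp only [Set.mem_Icc, Set.mem_union, Set.mem_singleton_iff]
    omega

/-- For all integers `t ≥ s ≥ 1`, the variable windmill `C₃ᵗC₄ˢ` (which has `3t + 4s`
edges) is graceful when `t ≡ 0, 1 (mod 4)` and near graceful when `t ≡ 2, 3 (mod 4)`. -/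
theorem C3C4_windmill_graceful_of_le (t s : ℕ) (hs : 1 ≤ s) (hst : s ≤ t) :
    ((t % 4 = 0 ∨ t % 4 = 1) →
      IsGraceful (Windmill (List.replicate t 3 ++ List.replicate s 4)) (3 * t + 4 * s)) ∧
    ((t % 4 = 2 ∨ t % 4 = 3) →
      IsNearGraceful (Windmill (List.replicate t 3 ++ List.replicate s 4)) (3 * t + 4 * s)) := by
  constructor
  · intro ht
    have hA : PairSys t id (fun c => t < c ∧ c ≤ 3 * t) :=
      (skolem t (by omega) ht).shift t _ (fun c hc => by unfold SkC at hc; omega)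
    by_cases h : s % 4 = 0 ∨ s % 4 = 1
    · have hB : PairSys s id (fun c => 3 * t < c ∧ c ≤ 3 * t + 2 * s) :=
        (skolem s hs h).shift (3 * t) _ (fun c hc => by unfold SkC at hc; omega)
      have hC : PairSys s id (fun c => 3 * t + 2 * s < c ∧ c ≤ 3 * t + 4 * s) :=
        (skolem s hs h).shift (3 * t + 2 * s) _ (fun c hc => by unfold SkC at hc; omega)
      (apply windmill_graceful_aux t s id _ _ _ hA hB hC <;> try simp only [id]) <;> intros <;> omega
    · have hB : PairSys s id
          (fun c => 3 * t < c ∧ c ≤ 3 * t + 2 * s + 1 ∧ c ≠ 3 * t + 2 * s) :=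
        (hooked s (by omega)).shift (3 * t) _ (fun c hc => by unfold HkC at hc; omega)
      have hC : PairSys s id
          (fun c => 3 * t + 2 * s ≤ c ∧ c ≤ 3 * t + 4 * s ∧ c ≠ 3 * t + 2 * s + 1) :=
        (hooked s (by omega)).reflect (3 * t + 4 * s + 1) _
          (fun c hc => by unfold HkC at hc; omega)
      (apply windmill_graceful_aux t s id _ _ _ hA hB hC <;> try simp only [id]) <;> intros <;> omega
  · intro ht
    have hA : PairSys t id (fun c => t < c ∧ c ≤ 3 * t + 1 ∧ c ≠ 3 * t) :=
      (hooked t ht).shift t _ (fun c hc => by unfold HkC at hc; omega)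
    by_cases h : s % 4 = 2 ∨ s % 4 = 3
    · have hB : PairSys s id (fun c => 3 * t ≤ c ∧ c ≤ 3 * t + 2 * s ∧ c ≠ 3 * t + 1) :=
        (hooked s h).reflect (3 * t + 2 * s + 1) _ (fun c hc => by unfold HkC at hc; omega)
      have hC : PairSys s id
          (fun c => 3 * t + 2 * s < c ∧ c ≤ 3 * t + 4 * s + 1 ∧ c ≠ 3 * t + 4 * s) :=
        (hooked s h).shift (3 * t + 2 * s) _ (fun c hc => by unfold HkC at hc; omega)
      (apply windmill_near_aux t s hs id _ _ _ hA hB hC <;> try simp only [id]) <;> intros <;> omega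
    by_cases h1 : s = 1
    · subst h1
      have hB : PairSys 1 (fun _ => 2) (fun c => c = 3 * t ∨ c = 3 * t + 2) :=
        ⟨fun _ => 3 * t, fun d _ _ => ⟨by simp, by simp, fun e _ _ => by dsimp only; omega⟩⟩
      have hC : PairSys 1 (fun _ => 2) (fun c => c = 3 * t + 3 ∨ c = 3 * t + 5) :=
        ⟨fun _ => 3 * t + 3, fun d _ _ => ⟨by simp, by simp, fun e _ _ => by dsimp only; omega⟩⟩
      apply windmill_near_aux t 1 hs (fun _ => 2) _ _ _ hA hB hC <;> intros <;> omega
    · have hB : PairSys s id (fun c => 3 * t ≤ c ∧ c ≤ 3 * t + 2 * s + 1 ∧ c ≠ 3 * t + 1 ∧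
          c ≠ 3 * t + 2 * s) :=
        (doubly s (by omega) (by omega)).shift (3 * t) _
          (fun c hc => by unfold DhC at hc; omega)
      have hC : PairSys s id (fun c => 3 * t + 2 * s ≤ c ∧ c ≤ 3 * t + 4 * s + 1 ∧
          c ≠ 3 * t + 2 * s + 1 ∧ c ≠ 3 * t + 4 * s) :=
        (doubly s (by omega) (by omega)).shift (3 * t + 2 * s) _
          (fun c hc => by unfold DhC at hc; omega)
      (apply windmill_near_aux t s hs id _ _ _ hA hB hC <;> try simp only [id]) <;> intros <;> omega
end

section
/- For all integers t, s with 4 ≤ t ≤ s ≤ (13t+37)/2, the variable windmill C_3^t C_4^s is graceful when t ≡ 0 or 1 (mod 4), and near graceful when t ≡ 2 or 3 (mod 4). -/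
set_option linter.unusedSimpArgs false

namespace C3C4

/-! ### Part 1: the quadruples used on the four-cycles -/

/-- A 4-cycle with centre `0` and vertex labels `u, w, v`, where `w` is opposite the centre. -/
abbrev Quad := ℕ × ℕ × ℕ

/-- Two shifted nested blocks of differences `h+1, h+3, …, 3h-1`, each used twice. -/
def shifted (p h : ℕ) : List Quad :=
  (List.range h).map fun i => (p + 3 * h - 1 - i, 3 * h - 1 - 2 * i, p + 4 * h - 1 - i)

/-- Two nested blocks of differences `1, 3, …, 2k-1`, each used twice. -/
def nested (p k : ℕ) : List Quad :=
  (List.range k).map fun i => (p + 2 * k - 1 - i, 2 * k - 1 - 2 * i, p + 4 * k - 1 - i)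

/-- The quadruples in `Q` cover the labels `p, …, p + 4|Q| - 1`. -/
structure Fill (p : ℕ) (Q : List Quad) : Prop where
  cover : ∀ x, p ≤ x → x < p + 4 * Q.length →
    ∃ q ∈ Q, x = q.1 ∨ x = q.2.2 ∨ x + q.2.1 = q.1 ∨ x + q.2.1 = q.2.2
  nodup : (Q.map fun q => q.2.1).Nodup
  pos : ∀ q ∈ Q, 0 < q.2.1
  low : ∀ q ∈ Q, p ≤ q.1 ∧ p ≤ q.2.2

theorem Fill.append {p : ℕ} {Q R : List Quad} (hQ : Fill p Q) (hR : Fill (p + 4 * Q.length) R)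
    (hd : ∀ q ∈ Q, ∀ r ∈ R, q.2.1 ≠ r.2.1) : Fill p (Q ++ R) where
  cover := by
    intro x h1 h2
    rw [List.length_append] at h2
    by_cases hx : x < p + 4 * Q.length
    · obtain ⟨q, hq, h⟩ := hQ.cover x h1 hx
      exact ⟨q, List.mem_append_left _ hq, h⟩
    · obtain ⟨q, hq, h⟩ := hR.cover x (by omega) (by omega)
      exact ⟨q, List.mem_append_right _ hq, h⟩
  nodup := by
    rw [List.map_append, List.nodup_append]
    refine ⟨hQ.nodup, hR.nodup, ?_⟩
    intro a ha b hb
    obtain ⟨q, hq, rfl⟩ := List.mem_map.1 ha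
    obtain ⟨r, hr, rfl⟩ := List.mem_map.1 hb
    exact hd q hq r hr
  pos := by
    intro q hq
    rcases List.mem_append.1 hq with h | h
    · exact hQ.pos q h
    · exact hR.pos q h
  low := by
    intro q hq
    rcases List.mem_append.1 hq with h | h
    · exact hQ.low q h
    · have := hR.low q h
      omega

theorem mem_shifted {p h : ℕ} {q : Quad} (hq : q ∈ shifted p h) :
    p + 2 * h ≤ q.1 ∧ p + 2 * h ≤ q.2.2 ∧ q.1 < p + 4 * h ∧ q.2.2 < p + 4 * h ∧
      h + 1 ≤ q.2.1 ∧ q.2.1 + 1 ≤ 3 * h ∧ (q.2.1 + h) % 2 = 1 := by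
  simp only [shifted, List.mem_map, List.mem_range] at hq
  obtain ⟨i, hi, rfl⟩ := hq
  dsimp only
  omega

@[simp] theorem length_shifted (p h : ℕ) : (shifted p h).length = h := by simp [shifted]

@[simp] theorem length_nested (p h : ℕ) : (nested p h).length = h := by simp [nested]

theorem fill_shifted (p h : ℕ) : Fill p (shifted p h) where
  cover := by
    intro x h1 h2
    rw [length_shifted] at h2
    simp only [shifted, List.mem_map, List.mem_range, exists_exists_and_eq_and]
    by_cases c1 : x < p + h
    · exact ⟨x - p, by omega, by omega⟩
    by_cases c2 : x < p + 2 * h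
    · exact ⟨x - p - h, by omega, by omega⟩
    by_cases c3 : x < p + 3 * h
    · exact ⟨p + 3 * h - 1 - x, by omega, by omega⟩
    · exact ⟨p + 4 * h - 1 - x, by omega, by omega⟩
  nodup := by
    simp only [shifted, List.map_map]
    refine List.Nodup.map_on ?_ List.nodup_range
    intro a ha b hb hab
    simp only [List.mem_range, Function.comp] at ha hb hab
    omega
  pos := fun q hq => by have := mem_shifted hq; omega
  low := fun q hq => by have := mem_shifted hq; omega

theorem mem_nested {p k : ℕ} {q : Quad} (hq : q ∈ nested p k) :
    p + k ≤ q.1 ∧ p + k ≤ q.2.2 ∧ q.2.1 % 2 = 1 ∧ q.2.1 < 2 * k := by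
  simp only [nested, List.mem_map, List.mem_range] at hq
  obtain ⟨i, hi, rfl⟩ := hq
  dsimp only
  omega

theorem fill_nested (p k : ℕ) : Fill p (nested p k) where
  cover := by
    intro x h1 h2
    rw [length_nested] at h2
    simp only [nested, List.mem_map, List.mem_range, exists_exists_and_eq_and]
    by_cases c1 : x < p + k
    · exact ⟨x - p, by omega, by omega⟩
    by_cases c2 : x < p + 2 * k
    · exact ⟨p + 2 * k - 1 - x, by omega, by omega⟩
    by_cases c3 : x < p + 3 * k
    · exact ⟨x - p - 2 * k, by omega, by omega⟩
    · exact ⟨p + 4 * k - 1 - x, by omega, by omega⟩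
  nodup := by
    simp only [nested, List.map_map]
    refine List.Nodup.map_on ?_ List.nodup_range
    intro a ha b hb hab
    simp only [List.mem_range, Function.comp] at ha hb hab
    omega
  pos := fun q hq => by have := mem_nested hq; omega
  low := fun q hq => by have := mem_nested hq; omega

/-- Differences `1` and `4`, each used twice, on eight consecutive labels. -/
theorem fill_one_four (p : ℕ) : Fill p [(p + 4, 4, p + 7), (p + 2, 1, p + 6)] where
  cover := by
    intro x h1 h2
    simp only [List.length_cons, List.length_nil] at h2
    simp only [List.mem_cons, List.not_mem_nil, or_false, exists_eq_or_imp, exists_eq_left]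
    omega
  nodup := by simp
  pos := by simp
  low := by simp

/-- The system of quadruples needed for the 4-cycles, occupying labels `t+1, …, t+4s`. -/
structure Good (t s : ℕ) (Q : List Quad) : Prop where
  len : Q.length = s
  fill : Fill (t + 1) Q
  le : ∀ q ∈ Q, q.2.1 ≤ t + 4 * s
  ne : ∀ q ∈ Q, ∀ r ∈ Q, q.2.1 ≠ r.1 ∧ q.2.1 ≠ r.2.2

theorem core (t h₁ h₂ y : ℕ) (Y X : List Quad) (hY : Fill (t + 1 + 4 * h₁) Y) (hy : Y.length = y)
    (hX : Fill (t + 1 + 4 * (h₁ + y + h₂)) X)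
    (hh₁ : h₁ ≤ t + 1) (hh₂ : h₂ = t + 4 * (h₁ + y) ∨ h₂ = t + 4 * (h₁ + y) + 1)
    (ht : 4 ≤ t)
    (hYw : ∀ q ∈ Y, q.2.1 ≤ t + 2 * h₁ ∧ ¬(h₁ + 1 ≤ q.2.1 ∧ q.2.1 + 1 ≤ 3 * h₁ ∧
      (q.2.1 + h₁) % 2 = 1))
    (hYu : ∀ q ∈ Y, q.1 ≤ t + 4 * (h₁ + y) ∧ q.2.2 ≤ t + 4 * (h₁ + y))
    (hXw : ∀ q ∈ X, q.2.1 ≤ t + 2 * h₁ ∧ ¬(h₁ + 1 ≤ q.2.1 ∧ q.2.1 + 1 ≤ 3 * h₁ ∧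
      (q.2.1 + h₁) % 2 = 1))
    (hYX : ∀ q ∈ Y, ∀ r ∈ X, q.2.1 ≠ r.2.1) :
    ∃ Q, Good t (h₁ + y + h₂ + X.length) Q := by
  have f1 : Fill (t + 1) (shifted (t + 1) h₁ ++ Y) := by
    refine (fill_shifted _ _).append (by simpa using hY) ?_
    intro q hq r hr
    have a1 := mem_shifted hq
    have a2 := hYw r hr
    omega
  have f2 : Fill (t + 1)
      ((shifted (t + 1) h₁ ++ Y) ++ shifted (t + 1 + 4 * (h₁ + y)) h₂) := by
    refine f1.append (by simpa [hy] using fill_shifted _ _) ?_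
    intro q hq r hr
    have a2 := mem_shifted hr
    rcases List.mem_append.1 hq with hq | hq
    · have a1 := mem_shifted hq
      omega
    · have a1 := hYw q hq
      omega
  have f3 : Fill (t + 1)
      (((shifted (t + 1) h₁ ++ Y) ++ shifted (t + 1 + 4 * (h₁ + y)) h₂) ++ X) := by
    refine f2.append (by simpa [hy, add_assoc] using hX) ?_
    intro q hq r hr
    have a2 := hXw r hr
    rcases List.mem_append.1 hq with hq | hq
    · rcases List.mem_append.1 hq with hq | hq
      · have a1 := mem_shifted hq
        omega
      · exact hYX q hq r hr
    · have a1 := mem_shifted hq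
      omega
  refine ⟨_, ⟨?_, f3, ?_, ?_⟩⟩
  · simp [hy, add_assoc]
  · intro q hq
    simp only [List.mem_append] at hq
    rcases hq with ((hq | hq) | hq) | hq
    · have a1 := mem_shifted hq
      omega
    · have a1 := hYw q hq
      omega
    · have a1 := mem_shifted hq
      omega
    · have a1 := hXw q hq
      omega
  · intro q hq r hr
    have b : (t + 1 + 2 * h₁ ≤ r.1 ∧ t + 1 + 2 * h₁ ≤ r.2.2) ∧
        ((r.1 ≤ t + 4 * (h₁ + y) ∧ r.2.2 ≤ t + 4 * (h₁ + y)) ∨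
          (t + 1 + 4 * (h₁ + y) + 2 * h₂ ≤ r.1 ∧ t + 1 + 4 * (h₁ + y) + 2 * h₂ ≤ r.2.2)) := by
      simp only [List.mem_append] at hr
      rcases hr with ((hr | hr) | hr) | hr
      · have a1 := mem_shifted hr
        omega
      · have a1 := hYu r hr
        have a2 := hY.low r hr
        omega
      · have a1 := mem_shifted hr
        omega
      · have a1 := hX.low r hr
        omega
    simp only [List.mem_append] at hq
    rcases hq with ((hq | hq) | hq) | hq
    · have a1 := mem_shifted hq
      omega
    · have a1 := hYw q hq
      omega
    · have a1 := mem_shifted hq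
      omega
    · have a1 := hXw q hq
      omega

/-- Small fillers: `e ≤ 3` four-cycles with small differences avoiding those of a block
`shifted _ a`. -/
theorem exists_extra (p a e : ℕ) (he : e ≤ 3) :
    ∃ X : List Quad, Fill p X ∧ X.length = e ∧
      ∀ q ∈ X, q.2.1 ≤ 5 ∧ (a = 0 ∨ q.2.1 ≤ a ∨ (a = 1 ∧ q.2.1 ≠ 2) ∨ (a = 2 ∧ q.2.1 = 4)) ∧
        (a ≠ 1 → q.2.1 ≤ 4) := by
  by_cases h1 : a = 1 ∨ e ≤ 1
  · refine ⟨nested p e, fill_nested p e, by simp, ?_⟩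
    intro q hq
    have := mem_nested hq
    omega
  have hb : ∀ p' : ℕ, ∀ q ∈ shifted p' 1, q.2.1 = 2 := by
    intro p' q hq
    have := mem_shifted hq
    omega
  by_cases h2 : e = 2
  · refine ⟨nested p 1 ++ shifted (p + 4) 1, ?_, by simp [h2], ?_⟩
    · refine (fill_nested _ _).append (by simpa using fill_shifted _ _) ?_
      intro q hq r hr
      have := mem_nested hq
      have := hb _ r hr
      omega
    · intro q hq
      rcases List.mem_append.1 hq with hq | hq
      · have := mem_nested hq
        omega
      · have := hb _ q hq
        omega
  by_cases h3 : a = 2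
  · refine ⟨[(p + 4, 4, p + 7), (p + 2, 1, p + 6)] ++ shifted (p + 8) 1, ?_, by simp; omega, ?_⟩
    · refine (fill_one_four _).append (by simpa using fill_shifted _ _) ?_
      intro q hq r hr
      have := hb _ r hr
      simp only [List.mem_cons, List.not_mem_nil, or_false] at hq
      rcases hq with rfl | rfl <;> simp [this]
    · intro q hq
      rcases List.mem_append.1 hq with hq | hq
      · simp only [List.mem_cons, List.not_mem_nil, or_false] at hq
        rcases hq with rfl | rfl <;> simp [h3]
      · have := hb _ q hq
        omega
  · refine ⟨nested p 2 ++ shifted (p + 8) 1, ?_, by simp; omega, ?_⟩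
    · refine (fill_nested _ _).append (by simpa using fill_shifted _ _) ?_
      intro q hq r hr
      have := mem_nested hq
      have := hb _ r hr
      omega
    · intro q hq
      rcases List.mem_append.1 hq with hq | hq
      · have := mem_nested hq
        omega
      · have := hb _ q hq
        omega

theorem exists_good_of_special (t ε : ℕ) (ht : t = 4 ∨ t = 6) (hε : ε ≤ 1) :
    ∃ Q, Good t (6 * t + 20 + ε) Q := by
  have hf : Fill (t + 1 + 4 * t) (shifted (t + 1 + 4 * t) 3 ++ nested (t + 1 + 4 * t + 12) 1) := by
    refine (fill_shifted _ _).append (by simpa using fill_nested _ _) ?_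
    intro q hq r hr
    have := mem_shifted hq
    have := mem_nested hr
    omega
  have := core t t (t + 4 * (t + 4) + ε) 4 _ [] hf (by simp)
    ⟨by intro x h1 h2; simp at h2; omega, by simp, by simp, by simp⟩ (by omega) (by omega) (by omega)
    (by
      intro q hq
      rcases List.mem_append.1 hq with hq | hq
      · have := mem_shifted hq
        omega
      · have := mem_nested hq
        omega)
    (by
      intro q hq
      rcases List.mem_append.1 hq with hq | hq
      · have := mem_shifted hq
        omega
      · simp only [nested, List.mem_map, List.mem_range] at hq
        obtain ⟨i, hi, rfl⟩ := hq
        dsimp only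
        omega)
    (by simp) (by simp)
  obtain ⟨Q, hQ⟩ := this
  refine ⟨Q, ?_⟩
  have e : 6 * t + 20 + ε = t + 4 + (t + 4 * (t + 4) + ε) + ([] : List Quad).length := by
    simp only [List.length_nil]
    omega
  rw [e]
  exact hQ

theorem exists_good (t s : ℕ) (ht : 4 ≤ t) (hts : t ≤ s) (hs : 2 * s ≤ 13 * t + 37) :
    ∃ Q, Good t s Q := by
  by_cases hsp : (t = 4 ∧ s = 44) ∨ (t = 6 ∧ s = 56) ∨ (t = 6 ∧ s = 57)
  · rcases hsp with ⟨rfl, rfl⟩ | ⟨rfl, rfl⟩ | ⟨rfl, rfl⟩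
    · exact exists_good_of_special 4 0 (by omega) (by omega)
    · exact exists_good_of_special 6 0 (by omega) (by omega)
    · exact exists_good_of_special 6 1 (by omega) (by omega)
  obtain ⟨q, r, hr, hqr⟩ : ∃ q r, r < 5 ∧ s = t + 5 * q + r :=
    ⟨(s - t) / 5, (s - t) % 5, by omega, by omega⟩
  obtain ⟨ε, e, hε, he, hre⟩ : ∃ ε e, ε ≤ 1 ∧ e ≤ 3 ∧ r = ε + e := by
    by_cases h : r = 4
    · exact ⟨1, 3, by omega, by omega, by omega⟩
    · exact ⟨0, r, by omega, by omega, by omega⟩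
  by_cases hq : q ≤ t + 1
  · obtain ⟨X, hX, hXl, hXw⟩ :=
      exists_extra (t + 1 + 4 * (q + 0 + (t + 4 * q + ε))) q e he
    have := core t q (t + 4 * q + ε) 0 [] X ⟨by intro x h1 h2; simp at h2; omega, by simp, by simp, by simp⟩
      rfl hX hq (by omega) ht (by simp) (by simp)
      (by
        intro x hx
        have := hXw x hx
        omega) (by simp)
    have e1 : s = q + 0 + (t + 4 * q + ε) + X.length := by omega
    rw [e1]
    exact this
  · obtain ⟨j, hj⟩ : ∃ j, q = t + 1 + j := ⟨q - (t + 1), by omega⟩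
    have hj3 : 3 * j ≤ t + 2 ∨ (t = 5 ∧ j = 3) := by omega
    obtain ⟨X, hX, hXl, hXw⟩ :=
      exists_extra (t + 1 + 4 * (t + 1 + j + (t + 4 * q + ε))) j e he
    have := core t (t + 1) (t + 4 * q + ε) j (shifted (t + 1 + 4 * (t + 1)) j) X
      (fill_shifted _ _) (by simp) hX le_rfl (by omega) ht
      (by
        intro x hx
        have := mem_shifted hx
        omega)
      (by
        intro x hx
        have := mem_shifted hx
        omega)
      (by
        intro x hx
        have := hXw x hx
        omega)
      (by
        intro x hx y hy
        have := mem_shifted hx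
        have := hXw y hy
        omega)
    have e1 : s = t + 1 + j + (t + 4 * q + ε) + X.length := by omega
    rw [e1]
    exact this



/-! ### Part 2: Skolem and hooked Skolem sequences -/

/-- `T` lists the position pairs of a Skolem sequence of order `n` (hooked if `hook`). -/
structure Skolem (n : ℕ) (hook : Prop) (T : List (ℕ × ℕ)) : Prop where
  len : T.length = n
  diff : ∀ d, 1 ≤ d → d ≤ n → ∃ p ∈ T, p.1 + d = p.2
  cover : ∀ x, 1 ≤ x → ((¬hook ∧ x ≤ 2 * n) ∨ (hook ∧ (x < 2 * n ∨ x = 2 * n + 1))) →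
    ∃ p ∈ T, x = p.1 ∨ x = p.2
  pos : ∀ p ∈ T, 1 ≤ p.1 ∧ 1 ≤ p.2

theorem skolem_zero (k : ℕ) (hk : 2 ≤ k) : ∃ T : List (ℕ × ℕ), Skolem (4 * k) False T := by
  obtain ⟨T, hT⟩ : ∃ T : List (ℕ × ℕ), T =
      (List.range (2 * k)).map (fun i => ((4 * k + i : ℕ), (8 * k - i : ℕ))) ++
      (List.range (k - 2)).map (fun i => ((i + 1 : ℕ), (4 * k - i - 2 : ℕ))) ++
      (List.range (k - 2)).map (fun i => ((k + i + 2 : ℕ), (3 * k - i - 1 : ℕ))) ++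
      [(k - 1, 3 * k), (k, k + 1), (2 * k, 4 * k - 1), (2 * k + 1, 6 * k)] := ⟨_, rfl⟩
  have m0 : ∀ i, i < 2 * k → (4 * k + i, 8 * k - i) ∈ T := by
    intro i hi
    simp only [hT, List.mem_append, List.mem_map, List.mem_range]
    exact Or.inl (Or.inl (Or.inl ((⟨i, hi, rfl⟩))))
  have m1 : ∀ i, i < k - 2 → (i + 1, 4 * k - i - 2) ∈ T := by
    intro i hi
    simp only [hT, List.mem_append, List.mem_map, List.mem_range]
    exact Or.inl (Or.inl (Or.inr (⟨i, hi, rfl⟩)))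
  have m2 : ∀ i, i < k - 2 → (k + i + 2, 3 * k - i - 1) ∈ T := by
    intro i hi
    simp only [hT, List.mem_append, List.mem_map, List.mem_range]
    exact Or.inl (Or.inr (⟨i, hi, rfl⟩))
  have n0 : (k - 1, 3 * k) ∈ T := by simp [hT]
  have n1 : (k, k + 1) ∈ T := by simp [hT]
  have n2 : (2 * k, 4 * k - 1) ∈ T := by simp [hT]
  have n3 : (2 * k + 1, 6 * k) ∈ T := by simp [hT]
  refine ⟨T, ?_, ?_, ?_, ?_⟩
  · simp only [hT, List.length_append, List.length_map, List.length_range, List.length_cons,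
      List.length_nil]
    omega
  · intro d h1 h2
    by_cases d0 : ∃ i, i < 2 * k ∧ 4 * k + i + d = 8 * k - i
    · obtain ⟨i, hi, h⟩ := d0
      exact ⟨_, m0 i hi, h⟩
    by_cases d1 : ∃ i, i < k - 2 ∧ i + 1 + d = 4 * k - i - 2
    · obtain ⟨i, hi, h⟩ := d1
      exact ⟨_, m1 i hi, h⟩
    by_cases d2 : ∃ i, i < k - 2 ∧ k + i + 2 + d = 3 * k - i - 1
    · obtain ⟨i, hi, h⟩ := d2
      exact ⟨_, m2 i hi, h⟩
    by_cases e0 : k - 1 + d = 3 * k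
    · exact ⟨_, n0, e0⟩
    by_cases e1 : k + d = k + 1
    · exact ⟨_, n1, e1⟩
    by_cases e2 : 2 * k + d = 4 * k - 1
    · exact ⟨_, n2, e2⟩
    by_cases e3 : 2 * k + 1 + d = 6 * k
    · exact ⟨_, n3, e3⟩
    exfalso
    have f0 := not_exists.1 d0 ((4 * k - d) / 2)
    have f1 := not_exists.1 d1 ((4 * k - 3 - d) / 2)
    have f2 := not_exists.1 d2 ((2 * k - 3 - d) / 2)
    omega
  · intro x h1 h2
    simp only [not_true_eq_false, not_false_eq_true, true_and, false_and, or_false, false_or] at h2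
    by_cases c0 : 4 * k ≤ x ∧ x < 4 * k + (2 * k)
    · exact ⟨_, m0 (x - 4 * k) (by omega), Or.inl (by dsimp only; omega)⟩
    by_cases d0 : x ≤ 8 * k ∧ 8 * k < x + (2 * k)
    · exact ⟨_, m0 (8 * k - x) (by omega), Or.inr (by dsimp only; omega)⟩
    by_cases c1 : 1 ≤ x ∧ x < 1 + (k - 2)
    · exact ⟨_, m1 (x - 1) (by omega), Or.inl (by dsimp only; omega)⟩
    by_cases d1 : x ≤ 4 * k - 2 ∧ 4 * k - 2 < x + (k - 2)
    · exact ⟨_, m1 (4 * k - 2 - x) (by omega), Or.inr (by dsimp only; omega)⟩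
    by_cases c2 : k + 2 ≤ x ∧ x < k + 2 + (k - 2)
    · exact ⟨_, m2 (x - (k + 2)) (by omega), Or.inl (by dsimp only; omega)⟩
    by_cases d2 : x ≤ 3 * k - 1 ∧ 3 * k - 1 < x + (k - 2)
    · exact ⟨_, m2 (3 * k - 1 - x) (by omega), Or.inr (by dsimp only; omega)⟩
    by_cases e0 : x = k - 1 ∨ x = 3 * k
    · exact ⟨_, n0, e0⟩
    by_cases e1 : x = k ∨ x = k + 1
    · exact ⟨_, n1, e1⟩
    by_cases e2 : x = 2 * k ∨ x = 4 * k - 1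
    · exact ⟨_, n2, e2⟩
    by_cases e3 : x = 2 * k + 1 ∨ x = 6 * k
    · exact ⟨_, n3, e3⟩
    exfalso
    omega
  · intro p hp
    simp only [hT, List.mem_append, List.mem_map, List.mem_range, List.mem_cons, List.not_mem_nil,
      or_false] at hp
    rcases hp with ((⟨i, hi, rfl⟩ | ⟨i, hi, rfl⟩) | ⟨i, hi, rfl⟩) | (rfl | rfl | rfl | rfl) <;> dsimp only <;> omega

theorem skolem_one (k : ℕ) (hk : 2 ≤ k) : ∃ T : List (ℕ × ℕ), Skolem (4 * k + 1) False T := by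
  obtain ⟨T, hT⟩ : ∃ T : List (ℕ × ℕ), T =
      (List.range (2 * k)).map (fun i => ((4 * k + i + 2 : ℕ), (8 * k - i + 2 : ℕ))) ++
      (List.range (k)).map (fun i => ((i + 1 : ℕ), (4 * k - i : ℕ))) ++
      (List.range (k - 2)).map (fun i => ((k + i + 3 : ℕ), (3 * k - i : ℕ))) ++
      [(k + 1, k + 2), (2 * k + 1, 6 * k + 2), (2 * k + 2, 4 * k + 1)] := ⟨_, rfl⟩
  have m0 : ∀ i, i < 2 * k → (4 * k + i + 2, 8 * k - i + 2) ∈ T := by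
    intro i hi
    simp only [hT, List.mem_append, List.mem_map, List.mem_range]
    exact Or.inl (Or.inl (Or.inl ((⟨i, hi, rfl⟩))))
  have m1 : ∀ i, i < k → (i + 1, 4 * k - i) ∈ T := by
    intro i hi
    simp only [hT, List.mem_append, List.mem_map, List.mem_range]
    exact Or.inl (Or.inl (Or.inr (⟨i, hi, rfl⟩)))
  have m2 : ∀ i, i < k - 2 → (k + i + 3, 3 * k - i) ∈ T := by
    intro i hi
    simp only [hT, List.mem_append, List.mem_map, List.mem_range]
    exact Or.inl (Or.inr (⟨i, hi, rfl⟩))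
  have n0 : (k + 1, k + 2) ∈ T := by simp [hT]
  have n1 : (2 * k + 1, 6 * k + 2) ∈ T := by simp [hT]
  have n2 : (2 * k + 2, 4 * k + 1) ∈ T := by simp [hT]
  refine ⟨T, ?_, ?_, ?_, ?_⟩
  · simp only [hT, List.length_append, List.length_map, List.length_range, List.length_cons,
      List.length_nil]
    omega
  · intro d h1 h2
    by_cases d0 : ∃ i, i < 2 * k ∧ 4 * k + i + 2 + d = 8 * k - i + 2
    · obtain ⟨i, hi, h⟩ := d0
      exact ⟨_, m0 i hi, h⟩
    by_cases d1 : ∃ i, i < k ∧ i + 1 + d = 4 * k - i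
    · obtain ⟨i, hi, h⟩ := d1
      exact ⟨_, m1 i hi, h⟩
    by_cases d2 : ∃ i, i < k - 2 ∧ k + i + 3 + d = 3 * k - i
    · obtain ⟨i, hi, h⟩ := d2
      exact ⟨_, m2 i hi, h⟩
    by_cases e0 : k + 1 + d = k + 2
    · exact ⟨_, n0, e0⟩
    by_cases e1 : 2 * k + 1 + d = 6 * k + 2
    · exact ⟨_, n1, e1⟩
    by_cases e2 : 2 * k + 2 + d = 4 * k + 1
    · exact ⟨_, n2, e2⟩
    exfalso
    have f0 := not_exists.1 d0 ((4 * k - d) / 2)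
    have f1 := not_exists.1 d1 ((4 * k - 1 - d) / 2)
    have f2 := not_exists.1 d2 ((2 * k - 3 - d) / 2)
    omega
  · intro x h1 h2
    simp only [not_true_eq_false, not_false_eq_true, true_and, false_and, or_false, false_or] at h2
    by_cases c0 : 4 * k + 2 ≤ x ∧ x < 4 * k + 2 + (2 * k)
    · exact ⟨_, m0 (x - (4 * k + 2)) (by omega), Or.inl (by dsimp only; omega)⟩
    by_cases d0 : x ≤ 8 * k + 2 ∧ 8 * k + 2 < x + (2 * k)
    · exact ⟨_, m0 (8 * k + 2 - x) (by omega), Or.inr (by dsimp only; omega)⟩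
    by_cases c1 : 1 ≤ x ∧ x < 1 + (k)
    · exact ⟨_, m1 (x - 1) (by omega), Or.inl (by dsimp only; omega)⟩
    by_cases d1 : x ≤ 4 * k ∧ 4 * k < x + (k)
    · exact ⟨_, m1 (4 * k - x) (by omega), Or.inr (by dsimp only; omega)⟩
    by_cases c2 : k + 3 ≤ x ∧ x < k + 3 + (k - 2)
    · exact ⟨_, m2 (x - (k + 3)) (by omega), Or.inl (by dsimp only; omega)⟩
    by_cases d2 : x ≤ 3 * k ∧ 3 * k < x + (k - 2)
    · exact ⟨_, m2 (3 * k - x) (by omega), Or.inr (by dsimp only; omega)⟩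
    by_cases e0 : x = k + 1 ∨ x = k + 2
    · exact ⟨_, n0, e0⟩
    by_cases e1 : x = 2 * k + 1 ∨ x = 6 * k + 2
    · exact ⟨_, n1, e1⟩
    by_cases e2 : x = 2 * k + 2 ∨ x = 4 * k + 1
    · exact ⟨_, n2, e2⟩
    exfalso
    omega
  · intro p hp
    simp only [hT, List.mem_append, List.mem_map, List.mem_range, List.mem_cons, List.not_mem_nil,
      or_false] at hp
    rcases hp with ((⟨i, hi, rfl⟩ | ⟨i, hi, rfl⟩) | ⟨i, hi, rfl⟩) | (rfl | rfl | rfl) <;> dsimp only <;> omega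

theorem skolem_two (k : ℕ) (hk : 1 ≤ k) : ∃ T : List (ℕ × ℕ), Skolem (4 * k + 2) True T := by
  obtain ⟨T, hT⟩ : ∃ T : List (ℕ × ℕ), T =
      (List.range (2 * k)).map (fun i => ((i + 1 : ℕ), (4 * k - i + 1 : ℕ))) ++
      (List.range (k - 1)).map (fun i => ((4 * k + i + 4 : ℕ), (8 * k - i + 3 : ℕ))) ++
      (List.range (k - 1)).map (fun i => ((5 * k + i + 3 : ℕ), (7 * k - i + 2 : ℕ))) ++
      [(2 * k + 1, 6 * k + 2), (4 * k + 2, 6 * k + 3), (4 * k + 3, 8 * k + 5), (7 * k + 3, 7 * k + 4)] := ⟨_, rfl⟩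
  have m0 : ∀ i, i < 2 * k → (i + 1, 4 * k - i + 1) ∈ T := by
    intro i hi
    simp only [hT, List.mem_append, List.mem_map, List.mem_range]
    exact Or.inl (Or.inl (Or.inl ((⟨i, hi, rfl⟩))))
  have m1 : ∀ i, i < k - 1 → (4 * k + i + 4, 8 * k - i + 3) ∈ T := by
    intro i hi
    simp only [hT, List.mem_append, List.mem_map, List.mem_range]
    exact Or.inl (Or.inl (Or.inr (⟨i, hi, rfl⟩)))
  have m2 : ∀ i, i < k - 1 → (5 * k + i + 3, 7 * k - i + 2) ∈ T := by
    intro i hi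
    simp only [hT, List.mem_append, List.mem_map, List.mem_range]
    exact Or.inl (Or.inr (⟨i, hi, rfl⟩))
  have n0 : (2 * k + 1, 6 * k + 2) ∈ T := by simp [hT]
  have n1 : (4 * k + 2, 6 * k + 3) ∈ T := by simp [hT]
  have n2 : (4 * k + 3, 8 * k + 5) ∈ T := by simp [hT]
  have n3 : (7 * k + 3, 7 * k + 4) ∈ T := by simp [hT]
  refine ⟨T, ?_, ?_, ?_, ?_⟩
  · simp only [hT, List.length_append, List.length_map, List.length_range, List.length_cons,
      List.length_nil]
    omega
  · intro d h1 h2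
    by_cases d0 : ∃ i, i < 2 * k ∧ i + 1 + d = 4 * k - i + 1
    · obtain ⟨i, hi, h⟩ := d0
      exact ⟨_, m0 i hi, h⟩
    by_cases d1 : ∃ i, i < k - 1 ∧ 4 * k + i + 4 + d = 8 * k - i + 3
    · obtain ⟨i, hi, h⟩ := d1
      exact ⟨_, m1 i hi, h⟩
    by_cases d2 : ∃ i, i < k - 1 ∧ 5 * k + i + 3 + d = 7 * k - i + 2
    · obtain ⟨i, hi, h⟩ := d2
      exact ⟨_, m2 i hi, h⟩
    by_cases e0 : 2 * k + 1 + d = 6 * k + 2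
    · exact ⟨_, n0, e0⟩
    by_cases e1 : 4 * k + 2 + d = 6 * k + 3
    · exact ⟨_, n1, e1⟩
    by_cases e2 : 4 * k + 3 + d = 8 * k + 5
    · exact ⟨_, n2, e2⟩
    by_cases e3 : 7 * k + 3 + d = 7 * k + 4
    · exact ⟨_, n3, e3⟩
    exfalso
    have f0 := not_exists.1 d0 ((4 * k - d) / 2)
    have f1 := not_exists.1 d1 ((4 * k - 1 - d) / 2)
    have f2 := not_exists.1 d2 ((2 * k - 1 - d) / 2)
    omega
  · intro x h1 h2
    simp only [not_true_eq_false, not_false_eq_true, true_and, false_and, or_false, false_or] at h2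
    by_cases c0 : 1 ≤ x ∧ x < 1 + (2 * k)
    · exact ⟨_, m0 (x - 1) (by omega), Or.inl (by dsimp only; omega)⟩
    by_cases d0 : x ≤ 4 * k + 1 ∧ 4 * k + 1 < x + (2 * k)
    · exact ⟨_, m0 (4 * k + 1 - x) (by omega), Or.inr (by dsimp only; omega)⟩
    by_cases c1 : 4 * k + 4 ≤ x ∧ x < 4 * k + 4 + (k - 1)
    · exact ⟨_, m1 (x - (4 * k + 4)) (by omega), Or.inl (by dsimp only; omega)⟩
    by_cases d1 : x ≤ 8 * k + 3 ∧ 8 * k + 3 < x + (k - 1)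
    · exact ⟨_, m1 (8 * k + 3 - x) (by omega), Or.inr (by dsimp only; omega)⟩
    by_cases c2 : 5 * k + 3 ≤ x ∧ x < 5 * k + 3 + (k - 1)
    · exact ⟨_, m2 (x - (5 * k + 3)) (by omega), Or.inl (by dsimp only; omega)⟩
    by_cases d2 : x ≤ 7 * k + 2 ∧ 7 * k + 2 < x + (k - 1)
    · exact ⟨_, m2 (7 * k + 2 - x) (by omega), Or.inr (by dsimp only; omega)⟩
    by_cases e0 : x = 2 * k + 1 ∨ x = 6 * k + 2
    · exact ⟨_, n0, e0⟩
    by_cases e1 : x = 4 * k + 2 ∨ x = 6 * k + 3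
    · exact ⟨_, n1, e1⟩
    by_cases e2 : x = 4 * k + 3 ∨ x = 8 * k + 5
    · exact ⟨_, n2, e2⟩
    by_cases e3 : x = 7 * k + 3 ∨ x = 7 * k + 4
    · exact ⟨_, n3, e3⟩
    exfalso
    omega
  · intro p hp
    simp only [hT, List.mem_append, List.mem_map, List.mem_range, List.mem_cons, List.not_mem_nil,
      or_false] at hp
    rcases hp with ((⟨i, hi, rfl⟩ | ⟨i, hi, rfl⟩) | ⟨i, hi, rfl⟩) | (rfl | rfl | rfl | rfl) <;> dsimp only <;> omega

theorem skolem_three (k : ℕ) (hk : 2 ≤ k) : ∃ T : List (ℕ × ℕ), Skolem (4 * k - 1) True T := by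
  obtain ⟨T, hT⟩ : ∃ T : List (ℕ × ℕ), T =
      (List.range (2 * k - 2)).map (fun i => ((4 * k + i + 1 : ℕ), (8 * k - i - 3 : ℕ))) ++
      (List.range (k - 2)).map (fun i => ((i + 1 : ℕ), (4 * k - i - 2 : ℕ))) ++
      (List.range (k - 2)).map (fun i => ((k + i + 2 : ℕ), (3 * k - i - 1 : ℕ))) ++
      [(k - 1, 3 * k), (k, k + 1), (2 * k, 4 * k - 1), (2 * k + 1, 6 * k - 1), (4 * k, 8 * k - 1)] := ⟨_, rfl⟩
  have m0 : ∀ i, i < 2 * k - 2 → (4 * k + i + 1, 8 * k - i - 3) ∈ T := by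
    intro i hi
    simp only [hT, List.mem_append, List.mem_map, List.mem_range]
    exact Or.inl (Or.inl (Or.inl ((⟨i, hi, rfl⟩))))
  have m1 : ∀ i, i < k - 2 → (i + 1, 4 * k - i - 2) ∈ T := by
    intro i hi
    simp only [hT, List.mem_append, List.mem_map, List.mem_range]
    exact Or.inl (Or.inl (Or.inr (⟨i, hi, rfl⟩)))
  have m2 : ∀ i, i < k - 2 → (k + i + 2, 3 * k - i - 1) ∈ T := by
    intro i hi
    simp only [hT, List.mem_append, List.mem_map, List.mem_range]
    exact Or.inl (Or.inr (⟨i, hi, rfl⟩))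
  have n0 : (k - 1, 3 * k) ∈ T := by simp [hT]
  have n1 : (k, k + 1) ∈ T := by simp [hT]
  have n2 : (2 * k, 4 * k - 1) ∈ T := by simp [hT]
  have n3 : (2 * k + 1, 6 * k - 1) ∈ T := by simp [hT]
  have n4 : (4 * k, 8 * k - 1) ∈ T := by simp [hT]
  refine ⟨T, ?_, ?_, ?_, ?_⟩
  · simp only [hT, List.length_append, List.length_map, List.length_range, List.length_cons,
      List.length_nil]
    omega
  · intro d h1 h2
    by_cases d0 : ∃ i, i < 2 * k - 2 ∧ 4 * k + i + 1 + d = 8 * k - i - 3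
    · obtain ⟨i, hi, h⟩ := d0
      exact ⟨_, m0 i hi, h⟩
    by_cases d1 : ∃ i, i < k - 2 ∧ i + 1 + d = 4 * k - i - 2
    · obtain ⟨i, hi, h⟩ := d1
      exact ⟨_, m1 i hi, h⟩
    by_cases d2 : ∃ i, i < k - 2 ∧ k + i + 2 + d = 3 * k - i - 1
    · obtain ⟨i, hi, h⟩ := d2
      exact ⟨_, m2 i hi, h⟩
    by_cases e0 : k - 1 + d = 3 * k
    · exact ⟨_, n0, e0⟩
    by_cases e1 : k + d = k + 1
    · exact ⟨_, n1, e1⟩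
    by_cases e2 : 2 * k + d = 4 * k - 1
    · exact ⟨_, n2, e2⟩
    by_cases e3 : 2 * k + 1 + d = 6 * k - 1
    · exact ⟨_, n3, e3⟩
    by_cases e4 : 4 * k + d = 8 * k - 1
    · exact ⟨_, n4, e4⟩
    exfalso
    have f0 := not_exists.1 d0 ((4 * k - 4 - d) / 2)
    have f1 := not_exists.1 d1 ((4 * k - 3 - d) / 2)
    have f2 := not_exists.1 d2 ((2 * k - 3 - d) / 2)
    omega
  · intro x h1 h2
    simp only [not_true_eq_false, not_false_eq_true, true_and, false_and, or_false, false_or] at h2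
    by_cases c0 : 4 * k + 1 ≤ x ∧ x < 4 * k + 1 + (2 * k - 2)
    · exact ⟨_, m0 (x - (4 * k + 1)) (by omega), Or.inl (by dsimp only; omega)⟩
    by_cases d0 : x ≤ 8 * k - 3 ∧ 8 * k - 3 < x + (2 * k - 2)
    · exact ⟨_, m0 (8 * k - 3 - x) (by omega), Or.inr (by dsimp only; omega)⟩
    by_cases c1 : 1 ≤ x ∧ x < 1 + (k - 2)
    · exact ⟨_, m1 (x - 1) (by omega), Or.inl (by dsimp only; omega)⟩
    by_cases d1 : x ≤ 4 * k - 2 ∧ 4 * k - 2 < x + (k - 2)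
    · exact ⟨_, m1 (4 * k - 2 - x) (by omega), Or.inr (by dsimp only; omega)⟩
    by_cases c2 : k + 2 ≤ x ∧ x < k + 2 + (k - 2)
    · exact ⟨_, m2 (x - (k + 2)) (by omega), Or.inl (by dsimp only; omega)⟩
    by_cases d2 : x ≤ 3 * k - 1 ∧ 3 * k - 1 < x + (k - 2)
    · exact ⟨_, m2 (3 * k - 1 - x) (by omega), Or.inr (by dsimp only; omega)⟩
    by_cases e0 : x = k - 1 ∨ x = 3 * k
    · exact ⟨_, n0, e0⟩
    by_cases e1 : x = k ∨ x = k + 1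
    · exact ⟨_, n1, e1⟩
    by_cases e2 : x = 2 * k ∨ x = 4 * k - 1
    · exact ⟨_, n2, e2⟩
    by_cases e3 : x = 2 * k + 1 ∨ x = 6 * k - 1
    · exact ⟨_, n3, e3⟩
    by_cases e4 : x = 4 * k ∨ x = 8 * k - 1
    · exact ⟨_, n4, e4⟩
    exfalso
    omega
  · intro p hp
    simp only [hT, List.mem_append, List.mem_map, List.mem_range, List.mem_cons, List.not_mem_nil,
      or_false] at hp
    rcases hp with ((⟨i, hi, rfl⟩ | ⟨i, hi, rfl⟩) | ⟨i, hi, rfl⟩) | (rfl | rfl | rfl | rfl | rfl) <;> dsimp only <;> omega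

theorem skolem_small (n : ℕ) (hn : n = 4 ∨ n = 5) :
    ∃ T : List (ℕ × ℕ), Skolem n False T := by
  rcases hn with rfl | rfl
  · refine ⟨[(1, 2), (4, 6), (5, 8), (3, 7)], rfl, ?_, ?_, by simp⟩
    · intro d h1 h2
      interval_cases d <;> simp
    · intro d h1 h2
      have h2 : d ≤ 8 := by simpa using h2
      interval_cases d <;> simp
  · refine ⟨[(1, 2), (7, 9), (3, 6), (4, 8), (5, 10)], rfl, ?_, ?_, by simp⟩
    · intro d h1 h2
      interval_cases d <;> simp
    · intro d h1 h2
      have h2 : d ≤ 10 := by simpa using h2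
      interval_cases d <;> simp

theorem exists_skolem (t : ℕ) (ht : 4 ≤ t) (h : t % 4 = 0 ∨ t % 4 = 1) :
    ∃ T : List (ℕ × ℕ), Skolem t False T := by
  by_cases hs : t = 4 ∨ t = 5
  · exact skolem_small t hs
  rcases h with h | h
  · obtain ⟨k, rfl⟩ : ∃ k, t = 4 * k := ⟨t / 4, by omega⟩
    exact skolem_zero k (by omega)
  · obtain ⟨k, rfl⟩ : ∃ k, t = 4 * k + 1 := ⟨t / 4, by omega⟩
    exact skolem_one k (by omega)

theorem exists_hooked (t : ℕ) (ht : 4 ≤ t) (h : t % 4 = 2 ∨ t % 4 = 3) :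
    ∃ T : List (ℕ × ℕ), Skolem t True T := by
  rcases h with h | h
  · obtain ⟨k, rfl⟩ : ∃ k, t = 4 * k + 2 := ⟨t / 4, by omega⟩
    exact skolem_two k (by omega)
  · obtain ⟨k, rfl⟩ : ∃ k, t = 4 * k - 1 := ⟨t / 4 + 1, by omega⟩
    exact skolem_three k (by omega)


/-! ### Part 3: edges of windmills -/

/-- The `k`-th vertex met when walking around the `i`-th vane, starting at the centre. -/
def pv (L : List ℕ) (i : Fin L.length) (k : ℕ) : WindmillVertex L :=
  if h : 1 ≤ k ∧ k < L.get i then some ⟨i, ⟨k - 1, by omega⟩⟩ else none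

/-- The `k`-th edge met when walking around a vane. -/
def pe (L : List ℕ) (x : Σ i : Fin L.length, Fin (L.get i)) : Sym2 (WindmillVertex L) :=
  s(pv L x.1 x.2.val, pv L x.1 (x.2.val + 1))

theorem pv_some (L : List ℕ) (i : Fin L.length) (j : Fin (L.get i - 1)) :
    pv L i (j.val + 1) = some ⟨i, j⟩ := by
  have hj := j.isLt
  unfold pv
  rw [dif_pos (by omega)]
  simp

theorem pv_none (L : List ℕ) (i : Fin L.length) (k : ℕ) (h : k = 0 ∨ L.get i ≤ k) :
    pv L i k = none := by
  unfold pv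
  rw [dif_neg (by omega)]

theorem rel_pe (L : List ℕ) (a b : WindmillVertex L) (h : windmillRel L a b) :
    ∃ x, pe L x = s(a, b) := by
  rcases a with _ | ⟨i, j⟩ <;> rcases b with _ | ⟨i', j'⟩
  · exact h.elim
  · have h' : j'.val = 0 ∨ j'.val + 2 = L.get i' := h
    have hj := j'.isLt
    rcases h' with h' | h'
    · refine ⟨⟨i', ⟨0, by omega⟩⟩, ?_⟩
      have e := pv_some L i' j'
      rw [h'] at e
      simp only [pe]
      rw [e, pv_none L i' 0 (Or.inl rfl)]
    · refine ⟨⟨i', ⟨j'.val + 1, by omega⟩⟩, ?_⟩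
      simp only [pe]
      rw [pv_some, pv_none L i' _ (Or.inr (by omega)), Sym2.eq_swap]
  · exact h.elim
  · have h' : i.val = i'.val ∧ j'.val = j.val + 1 := h
    obtain ⟨h1, h2⟩ := h'
    obtain rfl : i = i' := Fin.ext h1
    have hj := j'.isLt
    refine ⟨⟨i, ⟨j.val + 1, by omega⟩⟩, ?_⟩
    simp only [pe]
    rw [pv_some, ← h2, pv_some]

theorem mem_edgeSet_pe (L : List ℕ) (e : Sym2 (WindmillVertex L))
    (he : e ∈ (Windmill L).edgeSet) : ∃ x, pe L x = e := by
  induction e using Sym2.ind with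
  | _ a b =>
    rw [SimpleGraph.mem_edgeSet, Windmill, SimpleGraph.fromRel_adj] at he
    rcases he.2 with h | h
    · exact rel_pe L a b h
    · rw [Sym2.eq_swap]
      exact rel_pe L b a h

theorem pe_mem (L : List ℕ) (hL : ∀ i, 3 ≤ L.get i) (x : Σ i : Fin L.length, Fin (L.get i)) :
    pe L x ∈ (Windmill L).edgeSet := by
  obtain ⟨i, k, hk⟩ := x
  have h3 := hL i
  rw [pe, SimpleGraph.mem_edgeSet, Windmill, SimpleGraph.fromRel_adj]
  dsimp only
  by_cases h0 : k = 0
  · subst h0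
    have e := pv_some L i ⟨0, by omega⟩
    dsimp only at e
    rw [pv_none L i 0 (Or.inl rfl), e]
    exact ⟨by simp, Or.inl (Or.inl rfl)⟩
  obtain ⟨k, rfl⟩ : ∃ k', k = k' + 1 := ⟨k - 1, by omega⟩
  have e := pv_some L i ⟨k, by omega⟩
  dsimp only at e
  rw [e]
  by_cases h1 : k + 2 = L.get i
  · rw [pv_none L i _ (Or.inr (by omega))]
    exact ⟨by simp, Or.inr (Or.inr h1)⟩
  · have e' := pv_some L i ⟨k + 1, by omega⟩
    dsimp only at e'
    rw [e']
    exact ⟨by simp, Or.inl ⟨rfl, rfl⟩⟩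

theorem inj_of_cover {ι : Type*} [Fintype ι] (g : ι → ℕ) (S : Finset ℕ)
    (hc : S.card = Fintype.card ι) (h : ∀ x ∈ S, ∃ i, g i = x) :
    Function.Injective g ∧ ∀ i, g i ∈ S := by
  classical
  have hsub : S ⊆ Finset.univ.image g := by
    intro x hx
    obtain ⟨i, hi⟩ := h x hx
    exact Finset.mem_image.2 ⟨i, Finset.mem_univ _, hi⟩
  have heq : S = Finset.univ.image g := by
    refine Finset.eq_of_subset_of_card_le hsub ?_
    rw [hc]
    exact Finset.card_image_le
  constructor
  · have hi := Finset.injOn_of_card_image_eq (s := Finset.univ) (f := g)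
      (by rw [← heq, hc, Finset.card_univ])
    exact fun a b hab => hi (by simp) (by simp) hab
  · intro i
    rw [heq]
    exact Finset.mem_image_of_mem _ (Finset.mem_univ _)

/-- The list of vane lengths of `C₃ᵗC₄ˢ`. -/
abbrev vanes (t s : ℕ) : List ℕ := List.replicate t 3 ++ List.replicate s 4

theorem vanes_get (t s : ℕ) (i : Fin (vanes t s).length) :
    (vanes t s).get i = if i.val < t then 3 else 4 := by
  rw [List.get_eq_getElem, List.getElem_append]
  simp

/-- Labels met when walking around the vane number `i`, starting with `0` at the centre. -/
def walkLabel (t : ℕ) (T : List (ℕ × ℕ)) (Q : List Quad) (i k : ℕ) : ℕ :=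
  if i < t then
    (if k = 1 then (T.getD i (0, 0)).1 else if k = 2 then (T.getD i (0, 0)).2 else 0)
  else
    (if k = 1 then (Q.getD (i - t) (0, 0, 0)).1
      else if k = 2 then (Q.getD (i - t) (0, 0, 0)).2.1
      else if k = 3 then (Q.getD (i - t) (0, 0, 0)).2.2 else 0)

/-- The vertex labelling. -/
def vlab (t s : ℕ) (T : List (ℕ × ℕ)) (Q : List Quad) : WindmillVertex (vanes t s) → ℕ
  | none => 0
  | some ⟨i, j⟩ => walkLabel t T Q i.val (j.val + 1)

theorem vlab_pv (t s : ℕ) (T : List (ℕ × ℕ)) (Q : List Quad) (i : Fin (vanes t s).length) (k : ℕ)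
    (hk : k ≤ (vanes t s).get i) : vlab t s T Q (pv _ i k) = walkLabel t T Q i.val k := by
  have hv := vanes_get t s i
  by_cases h : 1 ≤ k ∧ k < (vanes t s).get i
  · obtain ⟨k, rfl⟩ : ∃ k', k = k' + 1 := ⟨k - 1, by omega⟩
    have e := pv_some (vanes t s) i ⟨k, by omega⟩
    dsimp only at e
    rw [e]
    rfl
  · rw [pv_none _ i k (by omega)]
    change 0 = _
    unfold walkLabel
    split_ifs at hv ⊢ <;> first | rfl | omega

theorem edgeLabel_pe (t s : ℕ) (T : List (ℕ × ℕ)) (Q : List Quad)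
    (x : Σ i : Fin (vanes t s).length, Fin ((vanes t s).get i)) :
    edgeLabel (vlab t s T Q) (pe _ x) =
      ((walkLabel t T Q x.1.val x.2.val : ℤ) - walkLabel t T Q x.1.val (x.2.val + 1)).natAbs := by
  have := x.2.isLt
  rw [← vlab_pv t s T Q x.1 _ (by omega), ← vlab_pv t s T Q x.1 _ (by omega)]
  rfl

theorem reduction (t s : ℕ) (T : List (ℕ × ℕ)) (Q : List Quad) (S : Finset ℕ)
    (hT : T.length = t) (hQ : Q.length = s) (hS : S.card = 3 * t + 4 * s) (hS0 : 0 ∉ S)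
    (hcov : ∀ x ∈ S, (∃ p ∈ T, x = p.1 ∨ x = p.2 ∨ p.1 + x = p.2) ∨
      ∃ q ∈ Q, x = q.1 ∨ x = q.2.2 ∨ x + q.2.1 = q.1 ∨ x + q.2.1 = q.2.2)
    (hnd : (Q.map fun q => q.2.1).Nodup) (hpos : ∀ q ∈ Q, 0 < q.2.1)
    (hQT : ∀ q ∈ Q, ∀ p ∈ T, q.2.1 ≠ p.1 ∧ q.2.1 ≠ p.2)
    (hQQ : ∀ q ∈ Q, ∀ r ∈ Q, q.2.1 ≠ r.1 ∧ q.2.1 ≠ r.2.2) :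
    ∃ f : WindmillVertex (vanes t s) → ℕ, Function.Injective f ∧
      (∀ v, f v = 0 ∨ f v ∈ S ∨ ∃ q ∈ Q, f v = q.2.1) ∧
      Set.BijOn (edgeLabel f) (Windmill (vanes t s)).edgeSet S := by
  set f := vlab t s T Q with hf
  have hlen : (vanes t s).length = t + s := by simp [vanes]
  have hget := vanes_get t s
  have hcard : S.card = Fintype.card (Σ i : Fin (vanes t s).length, Fin ((vanes t s).get i)) := by
    rw [hS, Fintype.card_sigma]
    simp only [Fintype.card_fin]
    have : ∑ i : Fin (vanes t s).length, (vanes t s).get i = (vanes t s).sum := by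
      simp [Fin.sum_univ_getElem]
    rw [this]
    simp [vanes, mul_comm]
  have hTi : ∀ i (hi : i < t), T.getD i (0, 0) = T[i]'(by omega) := fun i hi =>
    List.getD_eq_getElem _ _ (by omega)
  have hQi : ∀ i (hi : i < s), Q.getD i (0, 0, 0) = Q[i]'(by omega) := fun i hi =>
    List.getD_eq_getElem _ _ (by omega)
  have hTm : ∀ i, i < t → T.getD i (0, 0) ∈ T := fun i hi => by
    rw [hTi i hi]
    exact List.getElem_mem _
  have hQm : ∀ i, i < s → Q.getD i (0, 0, 0) ∈ Q := fun i hi => by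
    rw [hQi i hi]
    exact List.getElem_mem _
  have hsur : ∀ y ∈ S, ∃ x, (fun x => edgeLabel f (pe (vanes t s) x)) x = y := by
    intro y hy
    rcases hcov y hy with ⟨p, hp, h⟩ | ⟨q, hq, h⟩
    · obtain ⟨i, hi, rfl⟩ := List.getElem_of_mem hp
      have hg := hget ⟨i, by omega⟩
      rw [if_pos (by simp; omega)] at hg
      have hw : ∀ k, walkLabel t T Q i k =
          if k = 1 then (T[i]).1 else if k = 2 then (T[i]).2 else 0 := by
        intro k
        rw [walkLabel, if_pos (by omega), hTi i (by omega)]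
      have key : ∀ k, k < 3 → ((walkLabel t T Q i k : ℤ) - walkLabel t T Q i (k + 1)).natAbs = y →
          ∃ x, (fun x => edgeLabel f (pe (vanes t s) x)) x = y := by
        intro k hk hky
        refine ⟨⟨⟨i, by omega⟩, ⟨k, by omega⟩⟩, ?_⟩
        dsimp only
        rw [hf, edgeLabel_pe]
        exact hky
      rcases h with h | h | h
      · refine key 0 (by omega) ?_
        rw [hw, hw]
        norm_num
        omega
      · refine key 2 (by omega) ?_
        rw [hw, hw]
        norm_num
        omega
      · refine key 1 (by omega) ?_
        rw [hw, hw]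
        norm_num
        omega
    · obtain ⟨i, hi, rfl⟩ := List.getElem_of_mem hq
      have hg := hget ⟨t + i, by omega⟩
      rw [if_neg (by simp)] at hg
      have hw : ∀ k, walkLabel t T Q (t + i) k =
          if k = 1 then (Q[i]).1 else if k = 2 then (Q[i]).2.1 else
            if k = 3 then (Q[i]).2.2 else 0 := by
        intro k
        rw [walkLabel, if_neg (by omega), Nat.add_sub_cancel_left, hQi i (by omega)]
      have key : ∀ k, k < 4 →
          ((walkLabel t T Q (t + i) k : ℤ) - walkLabel t T Q (t + i) (k + 1)).natAbs = y →
          ∃ x, (fun x => edgeLabel f (pe (vanes t s) x)) x = y := by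
        intro k hk hky
        refine ⟨⟨⟨t + i, by omega⟩, ⟨k, by omega⟩⟩, ?_⟩
        dsimp only
        rw [hf, edgeLabel_pe]
        exact hky
      rcases h with h | h | h | h
      · refine key 0 (by omega) ?_
        rw [hw, hw]
        norm_num
        omega
      · refine key 3 (by omega) ?_
        rw [hw, hw]
        norm_num
        omega
      · refine key 1 (by omega) ?_
        rw [hw, hw]
        norm_num
        omega
      · refine key 2 (by omega) ?_
        rw [hw, hw]
        norm_num
        omega
  obtain ⟨hinj, hmem⟩ := inj_of_cover _ S hcard hsur
  have hL : ∀ i, 3 ≤ (vanes t s).get i := by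
    intro i
    rw [hget i]
    split_ifs <;> omega
  -- classification of the non-central vertices
  have hcls : ∀ (i : Fin (vanes t s).length) (j : Fin ((vanes t s).get i - 1)),
      (∃ k : Fin ((vanes t s).get i), f (some ⟨i, j⟩) = edgeLabel f (pe _ ⟨i, k⟩) ∧
        ((k.val = 0 ∧ j.val = 0) ∨ (0 < k.val ∧ j.val + 2 = (vanes t s).get i)) ∧
        ∀ q ∈ Q, q.2.1 ≠ f (some ⟨i, j⟩)) ∨
      (t ≤ i.val ∧ j.val = 1 ∧ f (some ⟨i, j⟩) = (Q.getD (i.val - t) (0, 0, 0)).2.1) := by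
    intro i j
    have hg := hget i
    have hj := j.isLt
    have hi := i.isLt
    have hfv : f (some ⟨i, j⟩) = walkLabel t T Q i.val (j.val + 1) := rfl
    by_cases h0 : j.val = 0
    · left
      refine ⟨⟨0, by omega⟩, ?_, Or.inl ⟨rfl, h0⟩, ?_⟩
      · rw [hf, edgeLabel_pe, ← hf, hfv, h0]
        have : walkLabel t T Q i.val 0 = 0 := by simp [walkLabel]
        simp [this]
      · intro q hq
        rw [hfv, h0, walkLabel]
        split_ifs with h1 h2 <;> first | omega | skip
        · exact (hQT q hq _ (hTm _ h1)).1
        · exact (hQQ q hq _ (hQm _ (by omega))).1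
    by_cases h1 : j.val + 2 = (vanes t s).get i
    · left
      refine ⟨⟨j.val + 1, by omega⟩, ?_, Or.inr ⟨by simp, h1⟩, ?_⟩
      · rw [hf, edgeLabel_pe, ← hf, hfv]
        have : walkLabel t T Q i.val (j.val + 1 + 1) = 0 := by
          unfold walkLabel
          split_ifs at hg ⊢ <;> first | rfl | omega
        simp [this]
      · intro q hq
        rw [hfv, walkLabel]
        split_ifs at hg ⊢ with h1 <;> first | omega | skip
        · exact (hQT q hq _ (hTm _ h1)).2
        · exact (hQQ q hq _ (hQm _ (by omega))).2
    · right
      have hit : t ≤ i.val := by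
        by_contra hlt
        rw [if_pos (by omega)] at hg
        omega
      rw [if_neg (by omega)] at hg
      have hj1 : j.val = 1 := by omega
      refine ⟨hit, hj1, ?_⟩
      rw [hfv, hj1, walkLabel, if_neg (by omega)]
      simp
  refine ⟨f, ?_, ?_, ?_, ?_, ?_⟩
  · have hzero : ∀ v : (Σ i : Fin (vanes t s).length, Fin ((vanes t s).get i - 1)),
        f (some v) ≠ 0 := by
      rintro ⟨i, j⟩ h
      rcases hcls i j with ⟨k, h1, -⟩ | ⟨h1, h2, h3⟩
      · have := hmem ⟨i, k⟩
        rw [← h1, h] at this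
        exact hS0 this
      · have hi := i.isLt
        have := hpos _ (hQm (i.val - t) (by omega))
        omega
    rintro (_ | ⟨i, j⟩) (_ | ⟨i', j'⟩) h
    · rfl
    · exact (hzero _ h.symm).elim
    · exact (hzero _ h).elim
    · have hi := i.isLt
      have hi' := i'.isLt
      suffices hh : i = i' ∧ j.val = j'.val by
        obtain ⟨rfl, h2⟩ := hh
        obtain rfl : j = j' := Fin.ext h2
        rfl
      rcases hcls i j with ⟨k, h1, h2, h3⟩ | ⟨h1, h2, h3⟩ <;>
        rcases hcls i' j' with ⟨k', h1', h2', h3'⟩ | ⟨h1', h2', h3'⟩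
      · have e : (⟨i, k⟩ : Σ i : Fin (vanes t s).length, Fin ((vanes t s).get i)) = ⟨i', k'⟩ := by
          apply hinj
          dsimp only
          rw [← h1, ← h1', h]
        cases e
        exact ⟨rfl, by omega⟩
      · exact (h3 _ (hQm _ (by omega)) (h.trans h3').symm).elim
      · exact (h3' _ (hQm _ (by omega)) (h.symm.trans h3).symm).elim
      · rw [h3, h3', hQi _ (by omega), hQi _ (by omega)] at h
        have hidx := (List.Nodup.getElem_inj_iff hnd (i := i.val - t) (j := i'.val - t)
          (hi := by simp; omega) (hj := by simp; omega)).1 (by simpa using h)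
        exact ⟨Fin.ext (by omega), by omega⟩
  · rintro (_ | ⟨i, j⟩)
    · exact Or.inl rfl
    · rcases hcls i j with ⟨k, h1, -⟩ | ⟨h1, h2, h3⟩
      · right; left
        rw [h1]
        exact hmem ⟨i, k⟩
      · right; right
        have hi := i.isLt
        exact ⟨_, hQm _ (by omega), h3⟩
  · intro e he
    obtain ⟨x, rfl⟩ := mem_edgeSet_pe _ e he
    exact hmem x
  · intro e he e' he' h
    obtain ⟨x, rfl⟩ := mem_edgeSet_pe _ e he
    obtain ⟨x', rfl⟩ := mem_edgeSet_pe _ e' he'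
    rw [hinj h]
  · intro y hy
    obtain ⟨x, hx⟩ := hsur y hy
    exact ⟨pe _ x, pe_mem _ hL x, hx⟩

/-! ### Part 4: assembling the labelling -/

theorem assemble (t s : ℕ) (hook : Prop) (T : List (ℕ × ℕ)) (hT : Skolem t hook T)
    (Q : List Quad) (hQ : Good t s Q) (S : Finset ℕ) (hS : S.card = 3 * t + 4 * s) (hS0 : 0 ∉ S)
    (hmem : ∀ x ∈ S, x ≤ t + 4 * s ∨ ∃ y, x = y + (t + 4 * s) ∧ 1 ≤ y ∧
      ((¬hook ∧ y ≤ 2 * t) ∨ (hook ∧ (y < 2 * t ∨ y = 2 * t + 1)))) :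
    ∃ f : WindmillVertex (vanes t s) → ℕ, Function.Injective f ∧
      (∀ v, f v ∈ S ∨ f v ≤ t + 4 * s) ∧
      Set.BijOn (edgeLabel f) (Windmill (vanes t s)).edgeSet S := by
  obtain ⟨f, h1, h2, h3⟩ := reduction t s
    (T.map fun p => (p.1 + (t + 4 * s), p.2 + (t + 4 * s))) Q S
    (by rw [List.length_map, hT.len]) hQ.len hS hS0
    (by
      intro x hx
      have hx0 : x ≠ 0 := fun h => hS0 (h ▸ hx)
      simp only [List.mem_map, exists_exists_and_eq_and]
      rcases hmem x hx with h | ⟨y, rfl, h1, h2⟩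
      · by_cases hxt : x ≤ t
        · obtain ⟨p, hp, h⟩ := hT.diff x (by omega) hxt
          exact Or.inl ⟨p, hp, by omega⟩
        · exact Or.inr (hQ.fill.cover x (by omega) (by rw [hQ.len]; omega))
      · obtain ⟨p, hp, h⟩ := hT.cover y h1 h2
        exact Or.inl ⟨p, hp, by omega⟩)
    hQ.fill.nodup hQ.fill.pos
    (by
      intro q hq p hp
      obtain ⟨p', hp', rfl⟩ := List.mem_map.1 hp
      have a1 := hT.pos p' hp'
      have a2 := hQ.le q hq
      dsimp only
      omega)
    hQ.ne
  refine ⟨f, h1, ?_, h3⟩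
  intro v
  rcases h2 v with h | h | ⟨q, hq, h⟩
  · right; omega
  · exact Or.inl h
  · right
    have := hQ.le q hq
    omega

end C3C4


/-- For all integers `t, s` with `4 ≤ t ≤ s ≤ (13t + 37)/2` (equivalently `2s ≤ 13t + 37`),
the variable windmill `C₃ᵗC₄ˢ` (which has `3t + 4s` edges) is graceful when
`t ≡ 0, 1 (mod 4)` and near graceful when `t ≡ 2, 3 (mod 4)`. -/
theorem C3C4_windmill_graceful_of_ge (t s : ℕ) (ht : 4 ≤ t) (hts : t ≤ s)
    (hs : 2 * s ≤ 13 * t + 37) :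
    ((t % 4 = 0 ∨ t % 4 = 1) →
      IsGraceful (Windmill (List.replicate t 3 ++ List.replicate s 4)) (3 * t + 4 * s)) ∧
    ((t % 4 = 2 ∨ t % 4 = 3) →
      IsNearGraceful (Windmill (List.replicate t 3 ++ List.replicate s 4)) (3 * t + 4 * s)) := by
  constructor
  · intro h
    obtain ⟨T, hT⟩ := C3C4.exists_skolem t ht h
    obtain ⟨Q, hQ⟩ := C3C4.exists_good t s ht hts hs
    obtain ⟨f, h1, h2, h3⟩ := C3C4.assemble t s False T hT Q hQ (Finset.Icc 1 (3 * t + 4 * s))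
      (by simp) (by simp)
      (by
        intro x hx
        rw [Finset.mem_Icc] at hx
        by_cases hx' : x ≤ t + 4 * s
        · exact Or.inl hx'
        · exact Or.inr ⟨x - (t + 4 * s), by omega, by omega, Or.inl ⟨not_false, by omega⟩⟩)
    refine ⟨f, h1, ?_, ?_⟩
    · intro v
      rcases h2 v with hv | hv
      · exact (Finset.mem_Icc.1 hv).2
      · omega
    · rw [Finset.coe_Icc] at h3
      exact h3
  · intro h
    obtain ⟨T, hT⟩ := C3C4.exists_hooked t ht h
    obtain ⟨Q, hQ⟩ := C3C4.exists_good t s ht hts hs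
    obtain ⟨f, h1, h2, h3⟩ := C3C4.assemble t s True T hT Q hQ
      (Finset.Icc 1 (3 * t + 4 * s - 1) ∪ {3 * t + 4 * s + 1})
      (by
        rw [Finset.card_union_of_disjoint]
        · simp
          omega
        · rw [Finset.disjoint_singleton_right, Finset.mem_Icc]
          omega)
      (by simp)
      (by
        intro x hx
        rw [Finset.mem_union, Finset.mem_Icc, Finset.mem_singleton] at hx
        by_cases hx' : x ≤ t + 4 * s
        · exact Or.inl hx'
        · exact Or.inr ⟨x - (t + 4 * s), by omega, by omega, Or.inr ⟨trivial, by omega⟩⟩)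
    refine ⟨f, h1, ?_, Or.inr ?_⟩
    · intro v
      rcases h2 v with hv | hv
      · rw [Finset.mem_union, Finset.mem_Icc, Finset.mem_singleton] at hv
        omega
      · omega
    · rw [Finset.coe_union, Finset.coe_Icc, Finset.coe_singleton] at h3
      exact h3
end
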